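/- arXiv:1811.10271 — 2 statements merged into one kernel-verified Lean document; each statement's English description precedes it below -/
import Mathlib

section
/- If Δ is a balanced triangulation of the dunce hat whose singularity contains exactly 3 vertices, then Δ has at least 10 vertices. -/
open Finset

variable {V : Type} [DecidableEq V] {W : Type} [DecidableEq W]

/-- An abstract simplicial complex, given by its finite set of (nonempty) faces. -/
def IsCplx (K : Finset (Finset V)) : Prop :=
  ∅ ∉ K ∧ ∀ F ∈ K, ∀ G, G ⊆ F → G ≠ ∅ → G ∈ K

/-- The vertex set of a complex. -/
def verts (K : Finset (Finset V)) : Finset V := K.sup id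

/-- The number of `i`-dimensional faces. -/
def fnum (K : Finset (Finset V)) (i : ℕ) : ℕ := (K.filter fun F => F.card = i + 1).card

/-- The link of a face. -/
def link (K : Finset (Finset V)) (F : Finset V) : Finset (Finset V) :=
  K.filter fun G => Disjoint G F ∧ G ∪ F ∈ K

/-- A complex is pure `d`-dimensional. -/
def PureC (d : ℕ) (K : Finset (Finset V)) : Prop :=
  (∀ F ∈ K, F.card ≤ d + 1) ∧ ∀ F ∈ K, ∃ G ∈ K, F ⊆ G ∧ G.card = d + 1

/-- A proper `(d+1)`-coloring of the vertices. -/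
def ProperColoring (d : ℕ) (K : Finset (Finset V)) (κ : V → Fin (d + 1)) : Prop :=
  ∀ F ∈ K, Set.InjOn κ ↑F

/-- A `d`-dimensional complex is balanced if its graph is `(d+1)`-colorable. -/
def BalancedC (d : ℕ) (K : Finset (Finset V)) : Prop :=
  ∃ κ : V → Fin (d + 1), ProperColoring d K κ

/-- Connectivity of the underlying graph. -/
def Conn (K : Finset (Finset V)) : Prop :=
  ∀ u ∈ verts K, ∀ w ∈ verts K,
    Relation.ReflTransGen (fun a b => ({a, b} : Finset V) ∈ K) u w

/-- Isomorphism onto. -/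
def IsoTo (K : Finset (Finset V)) (L : Finset (Finset W)) : Prop :=
  ∃ f : V → W, Set.InjOn f ↑(verts K) ∧ L = K.image (Finset.image f)

/-- The boundary complex of the `(d+1)`-dimensional cross-polytope. -/
def stdCross (d : ℕ) : Finset (Finset (Fin (d + 1) × Bool)) :=
  (univ : Finset (Fin (d + 1) × Bool)).powerset.filter fun F =>
    F ≠ ∅ ∧ ∀ p ∈ F, ∀ q ∈ F, Prod.fst p = Prod.fst q → p = q

/-- The geometric realization of a simplicial complex. -/
def geomReal [Fintype V] (K : Finset (Finset V)) : Set (V → ℝ) :=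
  {f | (∀ v, 0 ≤ f v) ∧ (∑ v, f v) = 1 ∧ ∃ F ∈ K, {v | f v ≠ 0} = ↑F}

/-- Straight-line path on the edge from vertex `a` to vertex `b` of the triangle. -/
def epath (a b : Fin 3) (t : ℝ) : Fin 3 → ℝ := fun i => if i = a then 1 - t else if i = b then t else 0

/-- Identifications giving the dunce hat (boundary word `a a a⁻¹`). -/
def dhRel (x y : stdSimplex ℝ (Fin 3)) : Prop :=
  ∃ t : ℝ, 0 ≤ t ∧ t ≤ 1 ∧
    ((x.val = epath 0 1 t ∧ y.val = epath 1 2 t) ∨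
     (x.val = epath 0 1 t ∧ y.val = epath 0 2 t))

/-- The dunce hat: quotient of a triangle identifying its edges non-coherently. -/
def DunceHat : Type := Quot dhRel

instance : TopologicalSpace DunceHat := by unfold DunceHat; infer_instance

/-- A 1-dimensional complex is a circle (a triangulation of `S¹`). -/
def IsCircle (L : Finset (Finset V)) : Prop :=
  (∀ F ∈ L, F.card ≤ 2) ∧ (verts L).Nonempty ∧
  (∀ v ∈ verts L, (L.filter fun e => e.card = 2 ∧ v ∈ e).card = 2) ∧ Conn L

open scoped Classical in
/-- The vertices on the singular set: those whose link is not a circle. -/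
noncomputable def singVerts (K : Finset (Finset V)) : Finset V :=
  (verts K).filter fun v => ¬IsCircle (link K ({v} : Finset V))

/-- A triangulation of the dunce hat. -/
def IsDunceHatTri [Fintype V] (K : Finset (Finset V)) : Prop :=
  IsCplx K ∧ Nonempty (geomReal K ≃ₜ DunceHat)
/-- Homotopy lifting for the exponential. -/
theorem dh_log_homotopy {A : Type} [TopologicalSpace A] (H : unitInterval × A → ℂ)
    (hc : Continuous H) (hn : ∀ p, H p ≠ 0)
    (h0 : ∃ L : A → ℂ, Continuous L ∧ ∀ a, Complex.exp (L a) = H (0, a)) :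
    ∃ L : A → ℂ, Continuous L ∧ ∀ a, Complex.exp (L a) = H (1, a) := by
  obtain ⟨L, hL, hLe⟩ := h0
  let H' : C(unitInterval × A, {z : ℂ // z ≠ 0}) := ⟨fun p => ⟨H p, hn p⟩, by fun_prop⟩
  have h0' : ∀ a, H' (0, a) = (fun z : ℂ ↦ (⟨_, z.exp_ne_zero⟩ : {z : ℂ // z ≠ 0})) ((⟨L, hL⟩ : C(A, ℂ)) a) := by
    intro a
    apply Subtype.ext
    exact (hLe a).symm
  refine ⟨fun a => Complex.isCoveringMap_exp.liftHomotopy H' ⟨L, hL⟩ h0' (1, a), by fun_prop, ?_⟩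
  intro a
  have := congrFun (Complex.isCoveringMap_exp.liftHomotopy_lifts H' ⟨L, hL⟩ h0') (1, a)
  exact congrArg Subtype.val this

/-- A weak form of invariance of domain in the plane. -/
theorem dh_invariance (f : ℂ → ℂ) (hf : Continuous f) 
    (hinj : Set.InjOn f (Metric.closedBall 0 1)) :
    f '' (Metric.closedBall 0 1) ∈ nhds (f 0) := by
  by_contra hcon
  let A := Metric.sphere (0 : ℂ) 1
  have hA : ∀ z : A, ‖(z : ℂ)‖ = 1 := fun z => by simp [A]
  have hcomp : IsCompact (f '' Metric.sphere (0 : ℂ) 1) := (isCompact_sphere _ _).image hf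
  have hmem : ∀ z : ℂ, ‖z‖ ≤ 1 → z ∈ Metric.closedBall (0 : ℂ) 1 := fun z hz => by simpa using hz
  have h0 : f 0 ∉ f '' Metric.sphere (0 : ℂ) 1 := by
    rintro ⟨z, hz, hz'⟩
    have hz1 : ‖z‖ = 1 := by simpa using hz
    have := hinj (hmem z hz1.le) (hmem 0 (by simp)) hz'
    simp [this] at hz1
  obtain ⟨m, hm, hball⟩ := Metric.isOpen_iff.1 hcomp.isClosed.isOpen_compl _ h0
  obtain ⟨w, hw, hwn⟩ : ∃ w ∈ Metric.ball (f 0) m, w ∉ f '' (Metric.closedBall 0 1) := by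
    by_contra! h
    exact hcon (Filter.mem_of_superset (Metric.ball_mem_nhds _ hm) h)
  -- step 1
  have s1 := dh_log_homotopy (A := A) (fun p => f ((p.1 : ℝ) * (p.2 : ℂ)) - w) (by fun_prop)
    (by
      rintro ⟨t, z⟩ h
      refine hwn ⟨_, hmem _ ?_, sub_eq_zero.1 h⟩
      simp [hA z, abs_of_nonneg t.2.1, t.2.2])
    ⟨fun _ => Complex.log (f 0 - w), by fun_prop, fun a => by
      rw [Complex.exp_log]
      · simp
      · intro h
        exact hwn ⟨0, by simp, sub_eq_zero.1 h⟩⟩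
  have s2 := dh_log_homotopy (A := A) (fun p => f (p.2 : ℂ) - (w + (p.1 : ℝ) * (f 0 - w))) (by fun_prop)
    (by
      rintro ⟨t, z⟩ h
      have h1 : (w + (t : ℝ) * (f 0 - w)) ∈ Metric.ball (f 0) m := by
        have := (convex_ball (f 0) m) hw (Metric.mem_ball_self hm) (a := 1 - t) (b := t)
          (by linarith [t.2.2]) t.2.1 (by ring)
        convert this using 1
        simp
        ring
      apply hball h1
      exact ⟨z, z.2, sub_eq_zero.1 h⟩)
    (by simpa using s1)
  have s3 := dh_log_homotopy (A := A) (fun p => f (p.2 : ℂ) - f (- ((p.1 : ℝ) * (p.2 : ℂ)))) (by fun_prop)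
    (by
      rintro ⟨t, z⟩ h
      have h2 := hinj (hmem _ (hA z).le) (hmem _ (by simp [hA z, abs_of_nonneg t.2.1, t.2.2]))
        (sub_eq_zero.1 h)
      have hz0 : (z : ℂ) ≠ 0 := by
        intro h; have := hA z; simp [h] at this
      have h3 : ((1 + (t : ℝ) : ℝ) : ℂ) * z = 0 := by
        push_cast
        linear_combination h2
      rcases mul_eq_zero.1 h3 with h4 | h4
      · have : (1 + (t : ℝ) : ℝ) = 0 := by exact_mod_cast h4
        linarith [t.2.1]
      · exact hz0 h4)
    (by simpa using s2)
  obtain ⟨L, hL, hLe'⟩ := s3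
  have hLe : ∀ a : A, Complex.exp (L a) = f a - f (-(a : ℂ)) := by
    intro a
    rw [hLe' a]
    simp
  have hneg : ∀ a : A, ((-a : A) : ℂ) = -(a : ℂ) := fun a => rfl
  have hconn : PreconnectedSpace A := by
    apply Subtype.preconnectedSpace
    apply isPreconnected_sphere
    rw [Complex.rank_real_complex]; norm_num
  have hodd : ∀ z : A, Complex.exp (L (-z) - L z) = -1 := by
    intro z
    rw [Complex.exp_sub, hLe, hLe, hneg, neg_neg]
    have hne : f z - f (-z) ≠ 0 := by
      rw [← hLe]; exact Complex.exp_ne_zero _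
    rw [div_eq_iff hne]; ring
  -- the difference is locally constant
  have hcst : ∀ z w : A, L (-z) - L z = L (-w) - L w := by
    intro z w
    let g : A → ℂ := fun z => L (-z) - L z
    have hg : Continuous g := by fun_prop
    have := Complex.isCoveringMap_exp.eq_of_comp_eq (A := A) (g₁ := g) (g₂ := fun _ => g w) hg continuous_const
      (by
        funext y
        apply Subtype.ext
        simp [g, hodd]) w rfl
    exact congrFun this z
  let o : A := ⟨1, by simp [A]⟩
  have h1 := hcst o (-o)
  simp at h1
  have h2 : L (-o) - L o = 0 := by linear_combination h1 / 2
  have h3 := hodd o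
  rw [h2] at h3
  norm_num at h3

/-- Clamping to the unit interval. -/
def dhCl (t : ℝ) : ℝ := max 0 (min 1 t)

theorem dhCl_nonneg (t : ℝ) : 0 ≤ dhCl t := le_max_left _ _
theorem dhCl_le (t : ℝ) : dhCl t ≤ 1 := max_le zero_le_one (min_le_left _ _)
theorem dhCl_eq {t : ℝ} (h0 : 0 ≤ t) (h1 : t ≤ 1) : dhCl t = t := by
  rw [dhCl, min_eq_right h1, max_eq_right h0]
theorem dhCl_cont : Continuous dhCl := by unfold dhCl; fun_prop

/-- Source of the `i`-th edge of the triangle. -/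
def dhA : Fin 3 → Fin 3 := ![0, 1, 0]
/-- Target of the `i`-th edge of the triangle. -/
def dhB : Fin 3 → Fin 3 := ![1, 2, 2]

/-- The `i`-th page: a collar of the `i`-th edge. -/
noncomputable def dhPage (i : Fin 3) (t r : ℝ) : stdSimplex ℝ (Fin 3) :=
  ⟨fun j => (1 - dhCl r) * epath (dhA i) (dhB i) (dhCl t) j + dhCl r / 3, by
    have h1 := dhCl_nonneg t
    have h2 := dhCl_le t
    have h3 := dhCl_nonneg r
    have h4 := dhCl_le r
    constructor
    · intro j
      have : 0 ≤ epath (dhA i) (dhB i) (dhCl t) j := by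
        unfold epath
        split_ifs <;> linarith
      have := mul_nonneg (sub_nonneg.2 h4) this
      linarith
    · rw [Fin.sum_univ_three]
      fin_cases i <;> simp [epath, dhA, dhB] <;> ring⟩

theorem dhPage_cont (i : Fin 3) : Continuous fun p : ℝ × ℝ => dhPage i p.1 p.2 := by
  have := dhCl_cont
  refine Continuous.subtype_mk ?_ _
  refine continuous_pi fun j => ?_
  unfold epath
  split_ifs <;> fun_prop

/-- The quotient map. -/
def dhMk (x : stdSimplex ℝ (Fin 3)) : DunceHat := Quot.mk dhRel x

theorem dhMk_cont : Continuous dhMk := continuous_quot_mk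

/-- A function separating the points of the dunce hat. -/
noncomputable def dhPhi (x : stdSimplex ℝ (Fin 3)) : (Fin 3 → ℝ) ⊕ ℝ :=
  open scoped Classical in
  if 0 < x.val 0 ∧ 0 < x.val 1 ∧ 0 < x.val 2 then Sum.inl x.val else
    if x.val 0 = 1 ∨ x.val 1 = 1 ∨ x.val 2 = 1 then Sum.inr 0 else
    if x.val 2 = 0 then Sum.inr (x.val 1) else Sum.inr (x.val 2)

theorem dhPhi_rel (x y : stdSimplex ℝ (Fin 3)) (h : dhRel x y) : dhPhi x = dhPhi y := by
  obtain ⟨t, h0, h1, h | h⟩ := h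
  all_goals
    obtain ⟨hx, hy⟩ := h
    rcases eq_or_ne t 0 with rfl | ht0
    · simp [dhPhi, hx, hy, epath]
    rcases eq_or_ne t 1 with rfl | ht1
    · simp [dhPhi, hx, hy, epath]
    · have : 1 - t ≠ 1 := by intro h; apply ht0; linarith
      simp [dhPhi, hx, hy, epath, ht0, ht1]

theorem dhPhi_mk {x y : stdSimplex ℝ (Fin 3)} (h : dhMk x = dhMk y) : dhPhi x = dhPhi y :=
  congrArg (Quot.lift dhPhi dhPhi_rel) h

theorem dhPage_zero (i : Fin 3) (t : ℝ) : dhMk (dhPage i t 0) = dhMk (dhPage 0 t 0) := by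
  have h0 : dhCl 0 = 0 := dhCl_eq le_rfl zero_le_one
  have key : ∀ i, (dhPage i t 0).val = epath (dhA i) (dhB i) (dhCl t) := by
    intro i
    funext j
    simp [dhPage, h0]
  fin_cases i
  · rfl
  · exact (Quot.sound ⟨dhCl t, dhCl_nonneg t, dhCl_le t, Or.inl ⟨key 0, key 1⟩⟩).symm
  · exact (Quot.sound ⟨dhCl t, dhCl_nonneg t, dhCl_le t, Or.inr ⟨key 0, key 2⟩⟩).symm

/-- The singular loop. -/
noncomputable def dhLoop (t : ℝ) : DunceHat := dhMk (dhPage 0 t 0)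

theorem dhLoop_cont : Continuous dhLoop :=
  dhMk_cont.comp ((dhPage_cont 0).comp (Continuous.prodMk_left 0))

theorem dhLoop_closed : dhLoop 0 = dhLoop 1 := by
  rw [dhLoop, ← dhPage_zero 1 0]
  unfold dhLoop
  congr 1
  apply Subtype.ext
  have h0 : dhCl 0 = 0 := dhCl_eq le_rfl zero_le_one
  have h1 : dhCl 1 = 1 := dhCl_eq zero_le_one le_rfl
  funext j
  simp only [dhPage, h0, h1, epath, dhA, dhB]
  fin_cases j <;> simp

theorem dhPhi_loop {i : Fin 3} {t : ℝ} (h0 : 0 ≤ t) (h1 : t < 1) : dhPhi (dhPage i t 0) = Sum.inr t := by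
  rw [dhPhi_mk (dhPage_zero i t)]
  have hz : dhCl 0 = 0 := dhCl_eq le_rfl zero_le_one
  have ht : dhCl t = t := dhCl_eq h0 h1.le
  rcases eq_or_ne t 0 with rfl | ht0
  · simp [dhPhi, dhPage, hz, epath, dhA, dhB]
  · simp [dhPhi, dhPage, hz, ht, epath, dhA, dhB, ht0, h1.ne]

theorem dhPhi_page {i : Fin 3} {t r : ℝ} (h0 : 0 ≤ t) (h1 : t ≤ 1) (hr : 0 < r) (hr1 : r ≤ 1) :
    dhPhi (dhPage i t r) = Sum.inl (dhPage i t r).val := by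
  have ht : dhCl t = t := dhCl_eq h0 h1
  have hr' : dhCl r = r := dhCl_eq hr.le hr1
  have hpos : ∀ j, 0 < (dhPage i t r).val j := by
    intro j
    have : 0 ≤ epath (dhA i) (dhB i) t j := by
      unfold epath
      split_ifs <;> linarith
    have := mul_nonneg (sub_nonneg.2 hr1) this
    simp only [dhPage, ht, hr']
    linarith
  simp [dhPhi, hpos]

theorem dhLoop_inj {t s : ℝ} (h0 : 0 ≤ t) (h1 : t < 1) (k0 : 0 ≤ s) (k1 : s < 1)
    (h : dhLoop t = dhLoop s) : t = s := by
  have := dhPhi_mk h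
  rw [dhPhi_loop h0 h1, dhPhi_loop k0 k1] at this
  exact Sum.inr_injective this

theorem dhPage_inj {i k : Fin 3} {t r s q : ℝ} (ht0 : 0 < t) (ht1 : t < 1) (hs0 : 0 < s) (hs1 : s < 1)
    (hr0 : 0 ≤ r) (hr1 : r < 1) (hq0 : 0 ≤ q) (hq1 : q < 1)
    (h : dhMk (dhPage i t r) = dhMk (dhPage k s q)) : t = s ∧ r = q ∧ (r = 0 ∨ i = k) := by
  have h' := dhPhi_mk h
  rcases hr0.eq_or_lt with rfl | hr
  · rw [dhPhi_loop ht0.le ht1] at h'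
    rcases hq0.eq_or_lt with rfl | hq
    · rw [dhPhi_loop hs0.le hs1] at h'
      exact ⟨Sum.inr_injective h', rfl, Or.inl rfl⟩
    · rw [dhPhi_page hs0.le hs1.le hq hq1.le] at h'
      cases h'
  · rw [dhPhi_page ht0.le ht1.le hr hr1.le] at h'
    rcases hq0.eq_or_lt with rfl | hq
    · rw [dhPhi_loop hs0.le hs1] at h'
      cases h'
    · rw [dhPhi_page hs0.le hs1.le hq hq1.le] at h'
      have h2 := Sum.inl_injective h'
      have e0 := congrFun h2 0
      have e1 := congrFun h2 1
      have e2 := congrFun h2 2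
      simp only [dhPage, dhCl_eq ht0.le ht1.le, dhCl_eq hs0.le hs1.le, dhCl_eq hr0 hr1.le, dhCl_eq hq0 hq1.le] at e0 e1 e2
      have p1 : 0 < (1 - r) * t := mul_pos (by linarith) ht0
      have p2 : 0 < (1 - r) * (1 - t) := mul_pos (by linarith) (by linarith)
      have p3 : 0 < (1 - q) * s := mul_pos (by linarith) hs0
      have p4 : 0 < (1 - q) * (1 - s) := mul_pos (by linarith) (by linarith)
      have fin : ∀ {u : ℝ}, r = q → (1 - r) * t = (1 - q) * s → t = s := by
        rintro - rfl h
        exact mul_left_cancel₀ (by linarith) h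
      fin_cases i <;> fin_cases k <;> simp [epath, dhA, dhB] at e0 e1 e2 ⊢ <;>
        first
        | (exfalso; linarith)
        | (have hrq : r = q := by linarith
           exact ⟨fin (u := 0) hrq (by linarith), hrq⟩)

/-- Interior of the triangle. -/
def dhInt : Set (stdSimplex ℝ (Fin 3)) := {x | 0 < x.val 0 ∧ 0 < x.val 1 ∧ 0 < x.val 2}

theorem dhInt_not_loop {x : stdSimplex ℝ (Fin 3)} (hx : x ∈ dhInt) {t : ℝ} (h0 : 0 ≤ t) (h1 : t ≤ 1) :
    dhMk x ≠ dhLoop t := by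
  intro h
  rcases h1.eq_or_lt with rfl | h1
  · rw [← dhLoop_closed] at h
    have := dhPhi_mk h
    rw [dhPhi_loop le_rfl zero_lt_one, dhPhi, if_pos (show _ ∧ _ ∧ _ from hx)] at this
    cases this
  · have := dhPhi_mk h
    rw [dhPhi_loop h0 h1, dhPhi, if_pos (show _ ∧ _ ∧ _ from hx)] at this
    cases this

theorem dh_bdry {x : stdSimplex ℝ (Fin 3)} (hx : x ∉ dhInt) :
    ∃ t, 0 ≤ t ∧ t ≤ 1 ∧ dhMk x = dhLoop t := by
  have hn := x.2.1
  have hs := x.2.2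
  rw [Fin.sum_univ_three] at hs
  have hz : dhCl 0 = 0 := dhCl_eq le_rfl zero_le_one
  have key : ∀ (i : Fin 3) (t : ℝ), 0 ≤ t → t ≤ 1 → x.val = epath (dhA i) (dhB i) t →
      ∃ t, 0 ≤ t ∧ t ≤ 1 ∧ dhMk x = dhLoop t := by
    intro i t h0 h1 h
    refine ⟨t, h0, h1, ?_⟩
    rw [dhLoop, ← dhPage_zero i]
    congr 1
    apply Subtype.ext
    funext j
    simp [dhPage, hz, dhCl_eq h0 h1, h]
  have n0 := hn 0
  have n1 := hn 1
  have n2 := hn 2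
  by_cases h2 : x.val 2 = 0
  · refine key 0 (x.val 1) n1 (by linarith) ?_
    funext j
    fin_cases j <;> simp [epath, dhA, dhB] <;> linarith
  by_cases h0 : x.val 0 = 0
  · refine key 1 (x.val 2) n2 (by linarith) ?_
    funext j
    fin_cases j <;> simp [epath, dhA, dhB] <;> linarith
  by_cases h1 : x.val 1 = 0
  · refine key 2 (x.val 2) n2 (by linarith) ?_
    funext j
    fin_cases j <;> simp [epath, dhA, dhB] <;> linarith
  · exact absurd ⟨lt_of_le_of_ne n0 (Ne.symm h0), lt_of_le_of_ne n1 (Ne.symm h1),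
      lt_of_le_of_ne n2 (Ne.symm h2)⟩ hx

theorem dhInt_preconn : IsPreconnected dhInt := by
  have hconv : Convex ℝ {x : Fin 3 → ℝ | x ∈ stdSimplex ℝ (Fin 3) ∧ 0 < x 0 ∧ 0 < x 1 ∧ 0 < x 2} := by
    intro x hx y hy a b ha hb hab
    refine ⟨convex_stdSimplex ℝ (Fin 3) hx.1 hy.1 ha hb hab, ?_⟩
    have : ∀ i, 0 < x i → 0 < y i → 0 < (a • x + b • y) i := by
      intro i h1 h2
      simp only [Pi.add_apply, Pi.smul_apply, smul_eq_mul]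
      rcases ha.eq_or_lt with rfl | ha
      · have : b = 1 := by linarith
        simp [this, h2]
      · have := mul_pos ha h1
        have := mul_nonneg hb h2.le
        linarith
    exact ⟨this 0 hx.2.1 hy.2.1, this 1 hx.2.2.1 hy.2.2.1, this 2 hx.2.2.2 hy.2.2.2⟩
  have := hconv.isPreconnected
  rw [← Topology.IsInducing.subtypeVal.isPreconnected_image]
  convert this using 1
  ext x
  constructor
  · rintro ⟨y, hy, rfl⟩
    exact ⟨y.2, hy⟩
  · rintro ⟨h1, h2⟩
    exact ⟨⟨x, h1⟩, h2, rfl⟩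

/-- Pages of the book around a point of the singular loop. -/
noncomputable def dhBook (t : ℝ) (i : Fin 3) (z : ℂ) : DunceHat := dhMk (dhPage i (t + z.re) |z.im|)

theorem dhBook_cont (t : ℝ) (i : Fin 3) : Continuous (dhBook t i) :=
  dhMk_cont.comp ((dhPage_cont i).comp (by fun_prop : Continuous fun z : ℂ => (t + z.re, |z.im|)))

theorem dhBook_inj {t δ : ℝ} (h1 : δ < t) (h2 : δ < 1 - t) (h3 : δ < 1) {i k : Fin 3} {z w : ℂ}
    (hz : ‖z‖ ≤ δ) (hw : ‖w‖ ≤ δ) (h : dhBook t i z = dhBook t k w) :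
    z.re = w.re ∧ |z.im| = |w.im| ∧ (|z.im| = 0 ∨ i = k) := by
  have a1 := abs_le.1 (Complex.abs_re_le_norm z)
  have a2 := abs_le.1 (Complex.abs_re_le_norm w)
  have a3 := Complex.abs_im_le_norm z
  have a4 := Complex.abs_im_le_norm w
  have := dhPage_inj (by linarith) (by linarith) (by linarith) (by linarith) (abs_nonneg _)
    (by linarith) (abs_nonneg _) (by linarith) h
  exact ⟨by linarith [this.1], this.2⟩

/-- No neighbourhood of a point on the singular loop is planar. -/
theorem dh_nonplanar {X : Type} [TopologicalSpace X] (e : DunceHat → X) (he : Continuous e)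
    (hei : Function.Injective e) (φ : X → ℂ) (hφ : Continuous φ) (U : Set X) (hU : IsOpen U)
    (hinj : Set.InjOn φ U) {t : ℝ} (h0 : 0 < t) (h1 : t < 1) (hmem : e (dhLoop t) ∈ U) : False := by
  let g : ℂ → DunceHat := fun z => if 0 ≤ z.im then dhBook t 0 z else dhBook t 1 z
  have hb0 : ∀ i (z : ℂ), z.im = 0 → dhBook t i z = dhLoop (t + z.re) := by
    intro i z hz
    simp only [dhBook, hz, abs_zero]
    exact dhPage_zero i _
  have hg : Continuous g := by
    refine Continuous.if_le (dhBook_cont t 0) (dhBook_cont t 1) continuous_const Complex.continuous_im ?_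
    intro z hz
    rw [hb0 0 z hz.symm, hb0 1 z hz.symm]
  have hg0 : g 0 = dhLoop t := by
    simp only [g]
    rw [if_pos (by simp), hb0 0 0 rfl]
    simp
  have hn1 : (e ∘ g) ⁻¹' U ∈ nhds (0 : ℂ) :=
    (hU.preimage (he.comp hg)).mem_nhds (by simpa [hg0] using hmem)
  have hn2 : (e ∘ dhBook t 2) ⁻¹' U ∈ nhds (0 : ℂ) :=
    (hU.preimage (he.comp (dhBook_cont t 2))).mem_nhds (by
      have := hb0 2 0 rfl
      simp only [Complex.zero_re, add_zero] at this
      simpa [this] using hmem)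
  obtain ⟨ε, hε, hball⟩ := Metric.nhds_basis_closedBall.mem_iff.1 (Filter.inter_mem hn1 hn2)
  obtain ⟨δ, hδ0, hδ⟩ : ∃ δ : ℝ, 0 < δ ∧ δ < min ε (min t (min (1 - t) 1)) :=
    exists_between (by simp [hε, h0, h1])
  simp only [lt_min_iff] at hδ
  obtain ⟨d1, d2, d3, d4⟩ := hδ
  have hUg : ∀ z : ℂ, ‖z‖ ≤ δ → e (g z) ∈ U := fun z hz =>
    (hball (by simpa using hz.trans d1.le)).1
  have hUb : ∀ z : ℂ, ‖z‖ ≤ δ → e (dhBook t 2 z) ∈ U := fun z hz =>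
    (hball (by simpa using hz.trans d1.le)).2
  have hginj : ∀ z w : ℂ, ‖z‖ ≤ δ → ‖w‖ ≤ δ → g z = g w → z = w := by
    intro z w hz hw h
    simp only [g] at h
    have fin : z.re = w.re → z.im = w.im → z = w := fun a b => Complex.ext a b
    split_ifs at h with c1 c2 c2
    all_goals
      obtain ⟨b1, b2, b3⟩ := dhBook_inj d2 d3 d4 hz hw h
      refine fin b1 ?_
    · rwa [abs_of_nonneg c1, abs_of_nonneg c2] at b2
    · rcases b3 with b3 | b3
      · rw [b3] at b2
        rw [abs_eq_zero.1 b3, abs_eq_zero.1 b2.symm]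
      · exact absurd b3 (by decide)
    · rcases b3 with b3 | b3
      · rw [b3] at b2
        rw [abs_eq_zero.1 b3, abs_eq_zero.1 b2.symm]
      · exact absurd b3 (by decide)
    · rw [abs_of_neg (not_le.1 c1), abs_of_neg (not_le.1 c2)] at b2
      linarith
  have hsc : ∀ z : ℂ, z ∈ Metric.closedBall (0 : ℂ) 1 → ‖(δ : ℂ) * z‖ ≤ δ := by
    intro z hz
    have hz' : ‖z‖ ≤ 1 := by simpa using hz
    rw [norm_mul, Complex.norm_real, Real.norm_of_nonneg hδ0.le]
    nlinarith
  have key := dh_invariance (fun z => φ (e (g (δ * z)))) (by fun_prop) (by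
    intro z hz w hw h
    have := hginj _ _ (hsc z hz) (hsc w hw) (hei (hinj (hUg _ (hsc z hz)) (hUg _ (hsc w hw)) h))
    exact mul_left_cancel₀ (by exact_mod_cast hδ0.ne') this)
  simp only [mul_zero, hg0] at key
  have hk : Filter.Tendsto (fun s : ℝ => φ (e (dhBook t 2 (s * Complex.I)))) (nhds 0)
      (nhds (φ (e (dhLoop t)))) := by
    have hc : Continuous (fun s : ℝ => φ (e (dhBook t 2 (s * Complex.I)))) := by
      have := dhBook_cont t 2
      fun_prop
    have := hc.tendsto 0
    have h2 := hb0 2 0 rfl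
    simp only [Complex.zero_re, add_zero] at h2
    simpa [h2] using this
  obtain ⟨η, hη, hηb⟩ := Metric.nhds_basis_closedBall.mem_iff.1 (hk key)
  have hs0 : 0 < min η δ := lt_min hη hδ0
  obtain ⟨z, hz, hzs⟩ := hηb (show min η δ ∈ Metric.closedBall (0 : ℝ) η by
    simp only [Metric.mem_closedBall, dist_zero_right, Real.norm_of_nonneg hs0.le]
    exact min_le_left _ _)
  set s := min η δ
  have hsn : ‖(s : ℂ) * Complex.I‖ ≤ δ := by
    rw [norm_mul, Complex.norm_real, Real.norm_of_nonneg hs0.le]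
    rw [Complex.norm_I, mul_one]
    exact min_le_right _ _
  have h3 := hei (hinj (hUg _ (hsc z hz)) (hUb _ hsn) hzs)
  simp only [g] at h3
  have hne : |((s : ℂ) * Complex.I).im| ≠ 0 := by
    simpa using hs0.ne'
  split_ifs at h3
  all_goals
    obtain ⟨-, b2, b3⟩ := dhBook_inj d2 d3 d4 (hsc z hz) hsn h3
    rcases b3 with b3 | b3
    · exact hne (b2 ▸ b3)
    · exact absurd b3 (by decide)

theorem dh_mk_cont {X : Type} [TopologicalSpace X] {f g : X → ℝ} (hf : Continuous f)
    (hg : Continuous g) : Continuous fun x => (⟨f x, g x⟩ : ℂ) := by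
  have : (fun x => (⟨f x, g x⟩ : ℂ)) = fun x => ((f x : ℝ) : ℂ) + ((g x : ℝ) : ℂ) * Complex.I := by
    funext y
    apply Complex.ext <;> simp
  rw [this]
  fun_prop

/-- A circle does not embed in the line. -/
theorem dh_loop_not_real (u : ℝ → ℝ) (hu : ContinuousOn u (Set.Icc 0 1)) (h01 : u 0 = u 1)
    (hinj : Set.InjOn u (Set.Ico 0 1)) : False := by
  have hne : u 0 ≠ u (1 / 2) := by
    intro h
    have := hinj (by norm_num) (by norm_num) h
    norm_num at this
  have m1 : (u 0 + u (1 / 2)) / 2 ∈ Set.uIcc (u 0) (u (1 / 2)) := by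
    rw [Set.mem_uIcc]
    rcases le_total (u 0) (u (1 / 2)) with h | h
    · left; constructor <;> linarith
    · right; constructor <;> linarith
  have m2 : (u 0 + u (1 / 2)) / 2 ∈ Set.uIcc (u (1 / 2)) (u 1) := by
    rw [Set.uIcc_comm, ← h01]; exact m1
  have i1 : Set.uIcc (0 : ℝ) (1 / 2) = Set.Icc 0 (1 / 2) := Set.uIcc_of_le (by norm_num)
  have i2 : Set.uIcc (1 / 2 : ℝ) 1 = Set.Icc (1 / 2) 1 := Set.uIcc_of_le (by norm_num)
  obtain ⟨s, hs, hs'⟩ := intermediate_value_uIcc (f := u) (a := 0) (b := 1 / 2)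
    (hu.mono (by rw [i1]; exact Set.Icc_subset_Icc le_rfl (by norm_num))) m1
  obtain ⟨r, hr, hr'⟩ := intermediate_value_uIcc (f := u) (a := 1 / 2) (b := 1)
    (hu.mono (by rw [i2]; exact Set.Icc_subset_Icc (by norm_num) le_rfl)) m2
  rw [i1] at hs
  rw [i2] at hr
  have hr1 : r < 1 := by
    refine lt_of_le_of_ne hr.2 ?_
    rintro rfl
    apply hne; rw [← h01] at hr'; linarith
  have hsr := hinj ⟨hs.1, by linarith [hs.2]⟩ ⟨by linarith [hr.1], hr1⟩ (hs'.trans hr'.symm)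
  have : s = 1 / 2 := le_antisymm hs.2 (hsr ▸ hr.1)
  rw [this] at hs'
  apply hne; linarith

/-- Vertices completing `F` to a larger face. -/
def dhN [Fintype V] (K : Finset (Finset V)) (F : Finset V) : Finset V :=
  univ.filter fun w => w ∉ F ∧ insert w F ∈ K

/-- Support of a point. -/
theorem dh_supp [Fintype V] {K : Finset (Finset V)} {y : V → ℝ} (hy : y ∈ geomReal K) :
    ∃ F ∈ K, (∀ v, v ∈ F ↔ y v ≠ 0) ∧ ∑ v ∈ F, y v = 1 := by
  obtain ⟨-, h1, F, hF, hs⟩ := hy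
  have hm : ∀ v, v ∈ F ↔ y v ≠ 0 := by
    intro v
    have := Set.ext_iff.1 hs v
    simpa using this.symm
  refine ⟨F, hF, hm, ?_⟩
  rw [← h1]
  apply Finset.sum_subset (Finset.subset_univ _)
  intro v _ hv
  by_contra h
  exact hv ((hm v).2 h)

theorem dh_card_le [Fintype V] {K : Finset (Finset V)} (hbal : BalancedC 2 K) {F : Finset V}
    (hF : F ∈ K) : F.card ≤ 3 := by
  obtain ⟨κ, hκ⟩ := hbal
  have := Finset.card_le_card_of_injOn κ (t := univ) (fun _ _ => Finset.mem_univ _) (hκ F hF)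
  simpa using this

/-- Points of the singular loop lie on vertices or on edges with at least three triangles. -/
theorem dh_edge [Fintype V] {K : Finset (Finset V)} (hbal : BalancedC 2 K)
    (h : geomReal K ≃ₜ DunceHat) {t : ℝ} (h0 : 0 < t) (h1 : t < 1) {F : Finset V} (hF : F ∈ K)
    (hs : ∀ v, v ∈ F ↔ (h.symm (dhLoop t)).val v ≠ 0) :
    F.card ≤ 1 ∨ (F.card = 2 ∧ 3 ≤ (dhN K F).card) := by
  by_contra! hcon
  obtain ⟨hc1, hc2⟩ := hcon
  have hc3 := dh_card_le hbal hF
  let U : Set (geomReal K) := {y | ∀ v ∈ F, y.val v ≠ 0}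
  have hU : IsOpen U := by
    have : U = ⋂ v ∈ F, {y : geomReal K | y.val v ≠ 0} := by ext; simp [U]
    rw [this]
    refine isOpen_biInter_finset fun v _ => ?_
    exact isOpen_ne_fun ((continuous_apply v).comp continuous_subtype_val) continuous_const
  have hmem : h.symm (dhLoop t) ∈ U := fun v hv => (hs v).1 hv
  rcases (by omega : F.card = 2 ∨ F.card = 3) with hc | hc
  · have hN : (dhN K F).card ≤ 2 := by have := hc2 hc; omega
    obtain ⟨a, b, hab, rfl⟩ := Finset.card_eq_two.1 hc
    obtain ⟨w1, w2, hw⟩ : ∃ w1 w2, dhN K {a, b} ⊆ {w1, w2} := by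
      rcases (by omega : (dhN K {a, b}).card = 0 ∨ (dhN K {a, b}).card = 1 ∨
        (dhN K {a, b}).card = 2) with h | h | h
      · exact ⟨a, a, by rw [Finset.card_eq_zero.1 h]; simp⟩
      · obtain ⟨w, hw⟩ := Finset.card_eq_one.1 h
        exact ⟨w, w, by rw [hw]; simp⟩
      · obtain ⟨w, w', -, hw⟩ := Finset.card_eq_two.1 h
        exact ⟨w, w', by rw [hw]⟩
    let σ : V → ℝ := fun w => if w = w1 then 1 else -1
    have hσ : ∀ w ∈ dhN K {a, b}, ∀ w' ∈ dhN K {a, b}, σ w = σ w' → w = w' := by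
      intro w hw' w' hw'' h
      have e1 := hw hw'
      have e2 := hw hw''
      simp only [Finset.mem_insert, Finset.mem_singleton] at e1 e2
      simp only [σ] at h
      split_ifs at h with c1 c2 c2
      · rw [c1, c2]
      · norm_num at h
      · norm_num at h
      · rw [e1.resolve_left c1, e2.resolve_left c2]
    have hσ1 : ∀ w, σ w = 1 ∨ σ w = -1 := by
      intro w; simp only [σ]; split_ifs <;> simp
    let ψ : (V → ℝ) → ℝ := fun y => ∑ w ∈ univ \ {a, b}, σ w * y w
    have hψ : Continuous ψ := by fun_prop
    -- structure of the points of U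
    have hst : ∀ y ∈ U, (∀ w, w ∉ ({a, b} : Finset V) → y.val w = 0) ∧ ψ y.val = 0 ∨
        ∃ w ∈ dhN K {a, b}, 0 < y.val w ∧ ψ y.val = σ w * y.val w ∧
          ∀ v, v ∉ ({a, b} : Finset V) → v ≠ w → y.val v = 0 := by
      intro y hy
      obtain ⟨G, hG, hGs, -⟩ := dh_supp y.2
      have hsub : {a, b} ⊆ G := fun v hv => (hGs v).2 (hy v hv)
      have hGc := dh_card_le hbal hG
      by_cases hall : ∀ w, w ∉ ({a, b} : Finset V) → y.val w = 0
      · left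
        refine ⟨hall, Finset.sum_eq_zero fun w hw => ?_⟩
        rw [hall w (Finset.mem_sdiff.1 hw).2, mul_zero]
      · right
        push Not at hall
        obtain ⟨w, hwF, hw0⟩ := hall
        have hins : insert w {a, b} = G := by
          apply Finset.eq_of_subset_of_card_le
          · exact Finset.insert_subset ((hGs w).2 hw0) hsub
          · rw [Finset.card_insert_of_notMem hwF, hc]; exact hGc
        have hz : ∀ v, v ∉ ({a, b} : Finset V) → v ≠ w → y.val v = 0 := by
          intro v hv hvw
          by_contra hne
          have := (hGs v).2 hne
          rw [← hins, Finset.mem_insert] at this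
          exact this.elim hvw hv
        refine ⟨w, ?_, lt_of_le_of_ne (y.2.1 w) (Ne.symm hw0), ?_, hz⟩
        · simp only [dhN, Finset.mem_filter, Finset.mem_univ, true_and]
          exact ⟨hwF, hins ▸ hG⟩
        · apply Finset.sum_eq_single w
          · intro v hv hvw
            rw [hz v (Finset.mem_sdiff.1 hv).2 hvw, mul_zero]
          · intro hw
            exact absurd (Finset.mem_sdiff.2 ⟨Finset.mem_univ _, hwF⟩) hw
    refine dh_nonplanar (fun d => h.symm d) h.symm.continuous h.symm.injective
      (fun y => (⟨y.val a - y.val b, ψ y.val⟩ : ℂ)) ?_ U hU ?_ h0 h1 hmem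
    · exact dh_mk_cont (((continuous_apply a).comp continuous_subtype_val).sub
        ((continuous_apply b).comp continuous_subtype_val)) (hψ.comp continuous_subtype_val)
    · intro y hy y' hy' heq
      have q1 : y.val a - y.val b = y'.val a - y'.val b := congrArg Complex.re heq
      have q2 : ψ y.val = ψ y'.val := congrArg Complex.im heq
      have hout : ∀ v, v ∉ ({a, b} : Finset V) → y.val v = y'.val v := by
        intro v hv
        rcases hst y hy with ⟨z1, z2⟩ | ⟨w, wN, wp, wψ, wz⟩ <;>
        rcases hst y' hy' with ⟨z1', z2'⟩ | ⟨w', wN', wp', wψ', wz'⟩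
        · rw [z1 v hv, z1' v hv]
        · rcases hσ1 w' with e | e <;> rw [e] at wψ' <;> linarith
        · rcases hσ1 w with e | e <;> rw [e] at wψ <;> linarith
        · have hσe : σ w = σ w' := by
            rcases hσ1 w with e | e <;> rcases hσ1 w' with e' | e' <;> rw [e] at wψ <;>
              rw [e'] at wψ' <;> first | (rw [e, e']; done) | (exfalso; linarith)
          have hww := hσ w wN w' wN' hσe
          subst hww
          by_cases hvw : v = w
          · subst hvw
            rw [wψ, wψ'] at q2
            rcases hσ1 v with e | e <;> rw [e] at q2 <;> linarith
          · rw [wz v hv hvw, wz' v hv hvw]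
      have hsum : ∀ z : geomReal K, z.val a + z.val b + ∑ v ∈ univ \ {a, b}, z.val v = 1 := by
        intro z
        rw [← z.2.2.1, ← Finset.sum_sdiff (Finset.subset_univ {a, b}), Finset.sum_pair hab]
        ring
      have s1 := hsum y
      have s2 := hsum y'
      rw [Finset.sum_congr rfl (fun v hv => hout v (Finset.mem_sdiff.1 hv).2)] at s1
      apply Subtype.ext
      funext v
      by_cases hv : v ∈ ({a, b} : Finset V)
      · simp only [Finset.mem_insert, Finset.mem_singleton] at hv
        rcases hv with rfl | rfl <;> linarith
      · exact hout v hv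
  · obtain ⟨a, b, c, hab, hac, hbc, rfl⟩ := Finset.card_eq_three.1 hc
    have hst : ∀ y ∈ U, (∀ w, w ∉ ({a, b, c} : Finset V) → y.val w = 0) ∧
        y.val a + y.val b + y.val c = 1 := by
      intro y hy
      obtain ⟨G, hG, hGs, hsum⟩ := dh_supp y.2
      have hsub : {a, b, c} ⊆ G := fun v hv => (hGs v).2 (hy v hv)
      have hGc := dh_card_le hbal hG
      have heq := Finset.eq_of_subset_of_card_le hsub (by rw [hc]; exact hGc)
      subst heq
      constructor
      · intro w hw
        by_contra hne
        exact hw ((hGs w).2 hne)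
      · rw [Finset.sum_insert (by simp [hab, hac]), Finset.sum_pair hbc] at hsum
        linarith
    refine dh_nonplanar (fun d => h.symm d) h.symm.continuous h.symm.injective
      (fun y => (⟨y.val a, y.val b⟩ : ℂ)) ?_ U hU ?_ h0 h1 hmem
    · exact dh_mk_cont ((continuous_apply a).comp continuous_subtype_val)
        ((continuous_apply b).comp continuous_subtype_val)
    · intro y hy y' hy' heq
      have q1 : y.val a = y'.val a := congrArg Complex.re heq
      have q2 : y.val b = y'.val b := congrArg Complex.im heq
      obtain ⟨o1, s1⟩ := hst y hy
      obtain ⟨o2, s2⟩ := hst y' hy'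
      apply Subtype.ext
      funext v
      by_cases hv : v ∈ ({a, b, c} : Finset V)
      · simp only [Finset.mem_insert, Finset.mem_singleton] at hv
        rcases hv with rfl | rfl | rfl <;> linarith
      · rw [o1 v hv, o2 v hv]

theorem dh_mem_verts {K : Finset (Finset V)} {v : V} : v ∈ verts K ↔ ∃ F ∈ K, v ∈ F := by
  simp [verts, Finset.mem_sup]

/-- Edges in at least three triangles have singular end points. -/
theorem dh_sing [Fintype V] {K : Finset (Finset V)} (hK : IsCplx K) {F : Finset V} (hF : F ∈ K)
    (hc : F.card = 2) (hN : 3 ≤ (dhN K F).card) : F ⊆ singVerts K := by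
  have key : ∀ p q : V, p ≠ q → F = {p, q} → p ∈ singVerts K := by
    rintro p q hpq rfl
    by_contra hp
    simp only [singVerts, Finset.mem_filter, not_and, not_not] at hp
    have hcirc := hp (dh_mem_verts.2 ⟨_, hF, by simp⟩)
    have hq : q ∈ verts (link K {p}) := by
      refine dh_mem_verts.2 ⟨{q}, ?_, by simp⟩
      simp only [link, Finset.mem_filter]
      refine ⟨hK.2 _ hF _ (by simp) (by simp), by simpa using hpq.symm, ?_⟩
      rw [Finset.union_comm]; exact hF
    have h2 := hcirc.2.2.1 q hq
    have : (dhN K {p, q}).card ≤ ((link K {p}).filter fun e => e.card = 2 ∧ q ∈ e).card := by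
      apply Finset.card_le_card_of_injOn (fun w => {q, w})
      · intro w hw
        simp only [dhN, Finset.coe_filter, Finset.mem_univ, true_and, Set.mem_ofPred_eq,
          Finset.mem_insert, Finset.mem_singleton, not_or] at hw
        obtain ⟨⟨hwp, hwq⟩, hw⟩ := hw
        simp only [link, Finset.coe_filter, Set.mem_ofPred_eq, Finset.mem_filter]
        refine ⟨⟨hK.2 _ hw _ ?_ (by simp), ?_, ?_⟩, Finset.card_pair (Ne.symm hwq), by simp⟩
        · intro x; simp; tauto
        · simp [hpq, Ne.symm hwp]
        · convert hw using 1
          ext x; simp; tauto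
      · intro w hw w' hw' heq
        simp only [dhN, Finset.coe_filter, Finset.mem_univ, true_and, Set.mem_ofPred_eq,
          Finset.mem_insert, Finset.mem_singleton, not_or] at hw
        have : w ∈ ({q, w'} : Finset V) := by
          have : w ∈ ({q, w} : Finset V) := by simp
          simpa only [heq] using this
        simp only [Finset.mem_insert, Finset.mem_singleton] at this
        exact this.resolve_left hw.1.2
    omega
  obtain ⟨p, q, hpq, hFe⟩ := Finset.card_eq_two.1 hc
  intro x hx
  rw [hFe] at hx
  simp only [Finset.mem_insert, Finset.mem_singleton] at hx
  rcases hx with rfl | rfl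
  · exact key _ _ hpq hFe
  · exact key _ _ hpq.symm (by rw [hFe, Finset.pair_comm])

/-- Radial rigidity of the boundary of a triangle. -/
theorem dh_radial {y1 y2 y3 q1 q2 q3 r : ℝ} (a1 : 0 ≤ y1) (a2 : 0 ≤ y2) (a3 : 0 ≤ y3)
    (b1 : 0 ≤ q1) (b2 : 0 ≤ q2) (b3 : 0 ≤ q3) (hr : 0 ≤ r)
    (e1 : y1 - 1 / 3 = r * (q1 - 1 / 3)) (e2 : y2 - 1 / 3 = r * (q2 - 1 / 3))
    (hy : y1 + y2 + y3 = 1) (hq : q1 + q2 + q3 = 1)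
    (zy : y1 = 0 ∨ y2 = 0 ∨ y3 = 0) (zq : q1 = 0 ∨ q2 = 0 ∨ q3 = 0) :
    y1 = q1 ∧ y2 = q2 ∧ y3 = q3 := by
  have e3 : y3 - 1 / 3 = r * (q3 - 1 / 3) := by
    have h1 : y3 = 1 - y1 - y2 := by linarith
    have h2 : q3 = 1 - q1 - q2 := by linarith
    rw [h1, h2]; linarith
  have m1 := mul_nonneg hr b1
  have m2 := mul_nonneg hr b2
  have m3 := mul_nonneg hr b3
  have r1 : 1 ≤ r := by
    rcases zy with h | h | h <;> subst h <;> linarith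
  have r2 : r ≤ 1 := by
    rcases zq with h | h | h <;> subst h <;> linarith
  have : r = 1 := le_antisymm r2 r1
  subst this
  refine ⟨by linarith, by linarith, by linarith⟩

/-- Points on edges contained in at least three triangles. -/
def dhE3 [Fintype V] (K : Finset (Finset V)) : Set (V → ℝ) :=
  {x | ∃ F ∈ K, F.card = 2 ∧ 3 ≤ (dhN K F).card ∧ ∀ v, v ∉ F → x v = 0}

theorem dhE3_closed [Fintype V] (K : Finset (Finset V)) : IsClosed (dhE3 K) := by
  have : dhE3 K = ⋃ F ∈ K.filter (fun F => F.card = 2 ∧ 3 ≤ (dhN K F).card),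
      ⋂ v ∈ univ \ F, {x : V → ℝ | x v = 0} := by
    ext x
    simp [dhE3, and_assoc]
  rw [this]
  refine Set.Finite.isClosed_biUnion (Finset.finite_toSet _) fun F _ => ?_
  refine isClosed_biInter fun v _ => ?_
  exact isClosed_eq (continuous_apply v) continuous_const

/-- The whole singular loop lies on edges contained in at least three triangles. -/
theorem dh_loop_E3 [Fintype V] {K : Finset (Finset V)} (hK : IsCplx K) (hbal : BalancedC 2 K)
    (h : geomReal K ≃ₜ DunceHat) {t : ℝ} (h0 : 0 ≤ t) (h1 : t ≤ 1) :
    (h.symm (dhLoop t)).val ∈ dhE3 K := by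
  by_contra hcon
  let x : ℝ → V → ℝ := fun t => (h.symm (dhLoop t)).val
  have hx : Continuous x := continuous_subtype_val.comp (h.symm.continuous.comp dhLoop_cont)
  have hopen : IsOpen (x ⁻¹' (dhE3 K)ᶜ ∩ Set.Ioo 0 1) :=
    ((dhE3_closed K).isOpen_compl.preimage hx).inter isOpen_Ioo
  have hcl : t ∈ closure (Set.Ioo (0 : ℝ) 1) := by
    rw [closure_Ioo (by norm_num)]; exact ⟨h0, h1⟩
  have hne : (x ⁻¹' (dhE3 K)ᶜ ∩ Set.Ioo 0 1).Nonempty :=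
    mem_closure_iff.1 hcl _ ((dhE3_closed K).isOpen_compl.preimage hx) hcon
  obtain ⟨s0, hs0⟩ := hne
  have hinf := infinite_of_mem_nhds s0 (hopen.mem_nhds hs0)
  have hfin : (Set.range fun v : V => (Pi.single v 1 : V → ℝ)).Finite := Set.finite_range _
  have hmaps : Set.MapsTo x (x ⁻¹' (dhE3 K)ᶜ ∩ Set.Ioo 0 1)
      (Set.range fun v : V => (Pi.single v 1 : V → ℝ)) := by
    intro s hs
    obtain ⟨F, hF, hFs, hsum⟩ := dh_supp (h.symm (dhLoop s)).2
    rcases dh_edge hbal h hs.2.1 hs.2.2 hF hFs with hc | ⟨hc, hN⟩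
    · have hFne : F ≠ ∅ := fun h => hK.1 (h ▸ hF)
      have : F.card = 1 := le_antisymm hc (Finset.card_pos.2 (Finset.nonempty_iff_ne_empty.2 hFne))
      obtain ⟨v, rfl⟩ := Finset.card_eq_one.1 this
      refine ⟨v, ?_⟩
      funext w
      by_cases hw : w = v
      · subst hw
        simp only [Finset.sum_singleton] at hsum
        simp [x, hsum]
      · have : ¬ (x s w ≠ 0) := fun h' => hw (by simpa using (hFs w).2 h')
        exact (Pi.single_eq_of_ne hw _).trans (not_not.1 this).symm
    · exact absurd ⟨F, hF, hc, hN, fun v hv => by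
        by_contra h'
        exact hv ((hFs v).2 h')⟩ hs.1
  obtain ⟨s, hs, s', hs', hss, heq⟩ := hinf.exists_ne_map_eq_of_mapsTo hmaps hfin
  exact hss (dhLoop_inj hs.2.1.le hs.2.2 hs'.2.1.le hs'.2.2 (h.symm.injective (Subtype.ext heq)))

/-- The singular loop covers the whole boundary of the triangle spanned by the singular vertices. -/
theorem dh_surj [Fintype V] {K : Finset (Finset V)}
    (h : geomReal K ≃ₜ DunceHat) (a b c : V) (hab : a ≠ b) (hac : a ≠ c) (hbc : b ≠ c)
    (hT : ∀ t, 0 ≤ t → t ≤ 1 → (∀ v, v ∉ ({a, b, c} : Finset V) → (h.symm (dhLoop t)).val v = 0) ∧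
      ((h.symm (dhLoop t)).val a = 0 ∨ (h.symm (dhLoop t)).val b = 0 ∨ (h.symm (dhLoop t)).val c = 0))
    (q : V → ℝ) (hq0 : ∀ v, 0 ≤ q v) (hqs : q a + q b + q c = 1)
    (hqo : ∀ v, v ∉ ({a, b, c} : Finset V) → q v = 0) (hqz : q a = 0 ∨ q b = 0 ∨ q c = 0) :
    ∃ t, 0 ≤ t ∧ t ≤ 1 ∧ (h.symm (dhLoop t)).val = q := by
  by_contra! hcon
  let x : ℝ → V → ℝ := fun t => (h.symm (dhLoop t)).val
  have hx : Continuous x := continuous_subtype_val.comp (h.symm.continuous.comp dhLoop_cont)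
  have hx0 : ∀ t v, 0 ≤ x t v := fun t v => (h.symm (dhLoop t)).2.1 v
  have hxs : ∀ t, 0 ≤ t → t ≤ 1 → x t a + x t b + x t c = 1 := by
    intro t h0 h1
    rw [← (h.symm (dhLoop t)).2.2.1, ← Finset.sum_subset (Finset.subset_univ {a, b, c})
      (fun v _ hv => (hT t h0 h1).1 v hv), Finset.sum_insert (by simp [hab, hac]),
      Finset.sum_pair hbc]
    ring
  let z : (V → ℝ) → ℂ := fun y => ⟨y a - 1 / 3, y b - 1 / 3⟩
  have hz : Continuous z := dh_mk_cont (by fun_prop) (by fun_prop)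
  have hext : ∀ y y' : V → ℝ, (∀ v, v ∉ ({a, b, c} : Finset V) → y v = 0) →
      (∀ v, v ∉ ({a, b, c} : Finset V) → y' v = 0) → (y a = y' a ∧ y b = y' b ∧ y c = y' c) → y = y' := by
    rintro y y' o o' ⟨e1, e2, e3⟩
    funext v
    by_cases hv : v ∈ ({a, b, c} : Finset V)
    · simp only [Finset.mem_insert, Finset.mem_singleton] at hv
      rcases hv with rfl | rfl | rfl <;> assumption
    · rw [o v hv, o' v hv]
  have hzq : z q ≠ 0 := by
    intro h
    have e1 : q a - 1 / 3 = 0 := congrArg Complex.re h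
    have e2 : q b - 1 / 3 = 0 := congrArg Complex.im h
    rcases hqz with h | h | h <;> linarith
  have hslit : ∀ t, 0 ≤ t → t ≤ 1 → -z (x t) / z q ∈ Complex.slitPlane := by
    intro t h0 h1
    by_contra hns
    rw [Complex.mem_slitPlane_iff, not_or, not_lt, not_not] at hns
    obtain ⟨n1, n2⟩ := hns
    set r := (-z (x t) / z q).re with hr
    have e : -z (x t) / z q = (r : ℂ) := Complex.ext rfl (by simpa using n2)
    have e' : z (x t) = ((-r : ℝ) : ℂ) * z q := by
      rw [div_eq_iff hzq] at e
      push_cast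
      linear_combination -e
    have e1 : x t a - 1 / 3 = -r * (q a - 1 / 3) := by
      have := congrArg Complex.re e'
      rwa [Complex.re_ofReal_mul] at this
    have e2 : x t b - 1 / 3 = -r * (q b - 1 / 3) := by
      have := congrArg Complex.im e'
      rwa [Complex.im_ofReal_mul] at this
    exact hcon t h0 h1 (hext _ _ (hT t h0 h1).1 hqo (dh_radial (hx0 t a) (hx0 t b) (hx0 t c)
      (hq0 a) (hq0 b) (hq0 c) (by linarith) e1 e2 (hxs t h0 h1) hqs (hT t h0 h1).2 hqz))
  refine dh_loop_not_real (fun t => Complex.arg (-z (x t) / z q)) ?_ ?_ ?_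
  · intro t ht
    have c1 : ContinuousAt (fun t => -z (x t) / z q) t :=
      ((hz.comp hx).neg.div_const _).continuousAt
    exact (ContinuousAt.comp (f := fun t => -z (x t) / z q) (g := Complex.arg)
      (Complex.continuousAt_arg (hslit t ht.1 ht.2)) c1).continuousWithinAt
  · simp only [x, dhLoop_closed]
  · intro t ht s hs heq
    have st := hslit t ht.1 ht.2.le
    have ss := hslit s hs.1 hs.2.le
    have nt := Complex.slitPlane_ne_zero st
    have ns := Complex.slitPlane_ne_zero ss
    have e := (Complex.arg_eq_arg_iff nt ns).1 heq
    set r : ℝ := ‖-z (x s) / z q‖ / ‖-z (x t) / z q‖ with hr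
    have hr0 : 0 ≤ r := by positivity
    have e' : z (x s) = ((r : ℝ) : ℂ) * z (x t) := by
      have e2 : ((r : ℝ) : ℂ) * (-z (x t) / z q) = -z (x s) / z q := by
        rw [← e, hr]; push_cast; rfl
      field_simp at e2
      linear_combination e2
    have e1 : x s a - 1 / 3 = r * (x t a - 1 / 3) := by
      have := congrArg Complex.re e'
      rwa [Complex.re_ofReal_mul] at this
    have e2 : x s b - 1 / 3 = r * (x t b - 1 / 3) := by
      have := congrArg Complex.im e'
      rwa [Complex.im_ofReal_mul] at this
    have hxx : x s = x t := hext _ _ (hT s hs.1 hs.2.le).1 (hT t ht.1 ht.2.le).1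
      (dh_radial (hx0 s a) (hx0 s b) (hx0 s c) (hx0 t a) (hx0 t b) (hx0 t c) hr0 e1 e2
        (hxs s hs.1 hs.2.le) (hxs t ht.1 ht.2.le) (hT s hs.1 hs.2.le).2 (hT t ht.1 ht.2.le).2)
    exact dhLoop_inj ht.1 ht.2 hs.1 hs.2 (h.symm.injective (Subtype.ext hxx.symm))

/-- The barycenter of a face. -/
theorem dh_bary [Fintype V] {K : Finset (Finset V)} {F : Finset V} (hF : F ∈ K) (hc : F.card = 3) :
    (fun v => if v ∈ F then (1 / 3 : ℝ) else 0) ∈ geomReal K := by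
  refine ⟨fun v => by dsimp only; split_ifs <;> norm_num, ?_, F, hF, ?_⟩
  · rw [Finset.sum_ite_mem, Finset.univ_inter, Finset.sum_const, hc]
    norm_num
  · ext v
    simp

theorem dh_not_E3 [Fintype V] {K : Finset (Finset V)} {F : Finset V} (hc : F.card = 3) :
    (fun v => if v ∈ F then (1 / 3 : ℝ) else 0) ∉ dhE3 K := by
  rintro ⟨G, -, hG, -, hz⟩
  have : F ⊆ G := by
    intro v hv
    by_contra h
    have := hz v h
    simp [hv] at this
  have := Finset.card_le_card this
  omega

theorem dh_fin3 : ∀ i j k l : Fin 3, i ≠ j → i ≠ k → j ≠ k → l ≠ i → l ≠ j → l = k := by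
  intro i j k l
  simp only [ne_eq, Fin.ext_iff]
  omega

/-- Edges of the singular cycle are contained in at least three triangles. -/
theorem dh_edge3 [Fintype V] {K : Finset (Finset V)}
    (h : geomReal K ≃ₜ DunceHat) (a b c : V) (hab : a ≠ b) (hac : a ≠ c) (hbc : b ≠ c)
    (hE : ∀ t, 0 ≤ t → t ≤ 1 → (h.symm (dhLoop t)).val ∈ dhE3 K)
    (hT : ∀ t, 0 ≤ t → t ≤ 1 → (∀ v, v ∉ ({a, b, c} : Finset V) → (h.symm (dhLoop t)).val v = 0) ∧
      ((h.symm (dhLoop t)).val a = 0 ∨ (h.symm (dhLoop t)).val b = 0 ∨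
        (h.symm (dhLoop t)).val c = 0)) :
    {a, b} ∈ K ∧ 3 ≤ (dhN K {a, b}).card := by
  obtain ⟨t, h0, h1, ht⟩ := dh_surj h a b c hab hac hbc hT
    (fun v => if v ∈ ({a, b} : Finset V) then 1 / 2 else 0)
    (fun v => by split_ifs <;> norm_num)
    (by simp [hac.symm, hbc.symm]; norm_num)
    (by
      intro v hv
      rw [if_neg]
      intro hv'
      apply hv
      simp only [Finset.mem_insert, Finset.mem_singleton] at hv' ⊢
      tauto)
    (by simp [hac.symm, hbc.symm])
  obtain ⟨F, hF, hc, hN, hz⟩ := hE t h0 h1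
  rw [ht] at hz
  have hsub : {a, b} ⊆ F := by
    intro v hv
    by_contra hvF
    have := hz v hvF
    simp only [if_pos hv] at this
    norm_num at this
  have := Finset.eq_of_subset_of_card_le hsub (by rw [hc, Finset.card_pair hab])
  subst this
  exact ⟨hF, hN⟩



/-- The triangle on the singular vertices is not a face. -/
theorem dh_not_face [Fintype V] {K : Finset (Finset V)} (hbal : BalancedC 2 K)
    (h : geomReal K ≃ₜ DunceHat) (a b c : V) (hab : a ≠ b) (hac : a ≠ c) (hbc : b ≠ c)
    (hE : ∀ t, 0 ≤ t → t ≤ 1 → (h.symm (dhLoop t)).val ∈ dhE3 K)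
    (hT : ∀ t, 0 ≤ t → t ≤ 1 → (∀ v, v ∉ ({a, b, c} : Finset V) → (h.symm (dhLoop t)).val v = 0) ∧
      ((h.symm (dhLoop t)).val a = 0 ∨ (h.symm (dhLoop t)).val b = 0 ∨
        (h.symm (dhLoop t)).val c = 0))
    (hNab : {a, b} ∈ K ∧ 3 ≤ (dhN K {a, b}).card) : ({a, b, c} : Finset V) ∉ K := by
  have hsurj := dh_surj h a b c hab hac hbc hT
  intro habc
  have hc3 : ({a, b, c} : Finset V).card = 3 :=
    Finset.card_eq_three.2 ⟨a, b, c, hab, hac, hbc, rfl⟩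
  obtain ⟨d, hd, hdc⟩ := Finset.exists_mem_ne (by omega : 1 < (dhN K {a, b}).card) c
  simp only [dhN, Finset.mem_filter, Finset.mem_univ, true_and] at hd
  have hd3 : (insert d {a, b} : Finset V).card = 3 := by
    rw [Finset.card_insert_of_notMem hd.1, Finset.card_pair hab]
  have hdn : d ∉ ({a, b, c} : Finset V) := by
    intro hm
    apply hd.1
    simp only [Finset.mem_insert, Finset.mem_singleton] at hm ⊢
    tauto
  let C : Set (geomReal K) := (fun x => h.symm (dhMk x)) '' dhInt
  have hC : IsPreconnected C :=
    dhInt_preconn.image _ (h.symm.continuous.comp dhMk_cont).continuousOn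
  have hin : ∀ y : geomReal K, y.val ∉ dhE3 K → y ∈ C := by
    intro y hy
    obtain ⟨x, hx⟩ := Quot.exists_rep (h y)
    have hxy : h.symm (dhMk x) = y := by
      rw [dhMk, hx]; exact h.symm_apply_apply y
    refine ⟨x, ?_, hxy⟩
    by_contra hxi
    obtain ⟨t, h0, h1, ht⟩ := dh_bdry hxi
    apply hy
    rw [← hxy, ht]
    exact hE t h0 h1
  let y0 : geomReal K := ⟨_, dh_bary habc hc3⟩
  let y1 : geomReal K := ⟨_, dh_bary hd.2 hd3⟩
  have hy0 : y0 ∈ C := hin _ (dh_not_E3 hc3)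
  have hy1 : y1 ∈ C := hin _ (dh_not_E3 hd3)
  have hcv : ∀ v, Continuous fun y : geomReal K => y.val v := fun v =>
    (continuous_apply v).comp continuous_subtype_val
  let O1 : Set (geomReal K) := {y | y.val a ≠ 0 ∧ y.val b ≠ 0 ∧ y.val c ≠ 0}
  let O2 : Set (geomReal K) := ⋃ v ∈ {v : V | v ∉ ({a, b, c} : Finset V)}, {y | y.val v ≠ 0}
  have hO1 : IsOpen O1 :=
    (isOpen_ne_fun (hcv a) continuous_const).inter
      ((isOpen_ne_fun (hcv b) continuous_const).inter (isOpen_ne_fun (hcv c) continuous_const))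
  have hO2 : IsOpen O2 :=
    isOpen_biUnion fun v _ => isOpen_ne_fun (hcv v) continuous_const
  have hcov : C ⊆ O1 ∪ O2 := by
    intro y hy
    by_contra hyn
    rw [Set.mem_union, not_or] at hyn
    obtain ⟨n1, n2⟩ := hyn
    have o : ∀ v, v ∉ ({a, b, c} : Finset V) → y.val v = 0 := by
      intro v hv
      by_contra hne
      exact n2 (Set.mem_biUnion (show v ∈ {v : V | v ∉ ({a, b, c} : Finset V)} from hv) hne)
    have z : y.val a = 0 ∨ y.val b = 0 ∨ y.val c = 0 := by
      by_contra! hne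
      exact n1 hne
    have hsum : y.val a + y.val b + y.val c = 1 := by
      rw [← y.2.2.1, ← Finset.sum_subset (Finset.subset_univ {a, b, c})
        (fun v _ hv => o v hv), Finset.sum_insert (by simp [hab, hac]), Finset.sum_pair hbc]
      ring
    obtain ⟨t, h0, h1, ht⟩ := hsurj y.val y.2.1 hsum o z
    obtain ⟨x, hx, hxy⟩ := hy
    refine dhInt_not_loop hx h0 h1 (h.symm.injective ?_)
    exact hxy.trans (Subtype.ext ht).symm
  obtain ⟨y, -, m1, m2⟩ := hC O1 O2 hO1 hO2 hcov
    ⟨y0, hy0, by simp [O1, y0]⟩ ⟨y1, hy1, Set.mem_biUnion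
      (show d ∈ {v : V | v ∉ ({a, b, c} : Finset V)} from hdn) (by simp [y1])⟩
  simp only [O2, Set.mem_iUnion] at m2
  obtain ⟨v, hv, hv'⟩ := m2
  obtain ⟨G, hG, hGs, -⟩ := dh_supp y.2
  have hsub : insert v {a, b, c} ⊆ G := by
    intro w hw
    apply (hGs w).2
    simp only [Finset.mem_insert, Finset.mem_singleton] at hw
    rcases hw with rfl | rfl | rfl | rfl
    · exact hv'
    · exact m1.1
    · exact m1.2.1
    · exact m1.2.2
  have h4 := Finset.card_le_card hsub
  rw [Finset.card_insert_of_notMem hv, hc3] at h4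
  have := dh_card_le hbal hG
  omega

/-- If a balanced triangulation of the dunce hat has exactly 3 vertices on the
singularity, then it has at least 10 vertices. -/
theorem stmt6 {V : Type} [DecidableEq V] [Fintype V] (K : Finset (Finset V))
    (hdh : IsDunceHatTri K) (hbal : BalancedC 2 K)
    (hsing : (singVerts K).card = 3) :
    10 ≤ fnum K 0 := by
  obtain ⟨hK, ⟨h⟩⟩ := hdh
  obtain ⟨a, b, c, hab, hac, hbc, hS⟩ := Finset.card_eq_three.1 hsing
  have hE := fun t (h0 : 0 ≤ t) (h1 : t ≤ 1) => dh_loop_E3 hK hbal h h0 h1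
  have hT : ∀ t, 0 ≤ t → t ≤ 1 →
      (∀ v, v ∉ ({a, b, c} : Finset V) → (h.symm (dhLoop t)).val v = 0) ∧
      ((h.symm (dhLoop t)).val a = 0 ∨ (h.symm (dhLoop t)).val b = 0 ∨
        (h.symm (dhLoop t)).val c = 0) := by
    intro t h0 h1
    obtain ⟨F, hF, hc, hN, hz⟩ := hE t h0 h1
    have hsub := dh_sing hK hF hc hN
    rw [hS] at hsub
    refine ⟨fun v hv => hz v fun h => hv (hsub h), ?_⟩
    by_contra! hcon
    have hsub2 : {a, b, c} ⊆ F := by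
      intro v hv
      by_contra hvF
      have := hz v hvF
      simp only [Finset.mem_insert, Finset.mem_singleton] at hv
      rcases hv with rfl | rfl | rfl
      · exact hcon.1 this
      · exact hcon.2.1 this
      · exact hcon.2.2 this
    have := Finset.card_le_card hsub2
    rw [hc, Finset.card_eq_three.2 ⟨a, b, c, hab, hac, hbc, rfl⟩] at this
    omega
  -- all three edges are contained in at least three triangles
  have hNab := dh_edge3 h a b c hab hac hbc hE hT
  have hNbc := dh_edge3 h b c a hbc hab.symm hac.symm hE (by
    have : ({b, c, a} : Finset V) = {a, b, c} := by ext x; simp; tauto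
    rw [this]
    intro t h0 h1
    have := hT t h0 h1
    tauto)
  have hNac := dh_edge3 h a c b hac hab hbc.symm hE (by
    have : ({a, c, b} : Finset V) = {a, b, c} := by ext x; simp; tauto
    rw [this]
    intro t h0 h1
    have := hT t h0 h1
    tauto)
  have hnot := dh_not_face hbal h a b c hab hac hbc hE hT hNab
  -- counting
  obtain ⟨κ, hκ⟩ := hbal
  have hcol : ∀ F ∈ K, ∀ u ∈ F, ∀ v ∈ F, u ≠ v → κ u ≠ κ v := by
    intro F hF u hu v hv huv heq
    exact huv (hκ F hF hu hv heq)
  have kab : κ a ≠ κ b := hcol _ hNab.1 _ (by simp) _ (by simp) hab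
  have kbc : κ b ≠ κ c := hcol _ hNbc.1 _ (by simp) _ (by simp) hbc
  have kac : κ a ≠ κ c := hcol _ hNac.1 _ (by simp) _ (by simp) hac
  have hclass : ∀ p q r : V, p ≠ q → κ p ≠ κ q → κ p ≠ κ r → κ q ≠ κ r → {p, q} ∈ K → {q, r} ∈ K →
      ({p, q, r} : Finset V) ∉ K → 3 ≤ (dhN K {p, q}).card →
      4 ≤ (univ.filter fun v => {v} ∈ K ∧ κ v = κ r).card := by
    intro p q r hpq k1 k2 k3 hpqK hqrK hn hN
    have hrN : r ∉ dhN K {p, q} := by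
      intro hr
      simp only [dhN, Finset.mem_filter, Finset.mem_univ, true_and] at hr
      apply hn
      convert hr.2 using 1
      ext x; simp; tauto
    have hsub : insert r (dhN K {p, q}) ⊆ univ.filter fun v => {v} ∈ K ∧ κ v = κ r := by
      intro w hw
      simp only [Finset.mem_filter, Finset.mem_univ, true_and]
      rcases Finset.mem_insert.1 hw with rfl | hw
      · exact ⟨hK.2 _ hqrK _ (by simp) (by simp), rfl⟩
      · simp only [dhN, Finset.mem_filter, Finset.mem_univ, true_and, Finset.mem_insert,
          Finset.mem_singleton, not_or] at hw
        refine ⟨hK.2 _ hw.2 _ (by simp) (by simp), ?_⟩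
        exact dh_fin3 _ _ _ _ k1 k2 k3 (hcol _ hw.2 _ (by simp) _ (by simp) hw.1.1)
          (hcol _ hw.2 _ (by simp) _ (by simp) hw.1.2)
    have := Finset.card_le_card hsub
    rw [Finset.card_insert_of_notMem hrN] at this
    omega
  have c1 := hclass a b c hab kab kac kbc hNab.1 hNbc.1 hnot hNab.2
  have c2 := hclass b c a hbc kbc kab.symm kac.symm hNbc.1 (by rw [Finset.pair_comm]; exact hNac.1)
    (by
      intro hh; apply hnot; convert hh using 1
      ext x; simp; tauto) hNbc.2
  have c3 := hclass a c b hac kac kab kbc.symm hNac.1 (by rw [Finset.pair_comm]; exact hNbc.1)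
    (by
      intro hh; apply hnot; convert hh using 1
      ext x; simp; tauto) hNac.2
  have hdisj : ∀ i j : Fin 3, i ≠ j → Disjoint (univ.filter fun v => {v} ∈ K ∧ κ v = i)
      (univ.filter fun v => {v} ∈ K ∧ κ v = j) := by
    intro i j hij
    rw [Finset.disjoint_left]
    intro v hv hv'
    simp only [Finset.mem_filter, Finset.mem_univ, true_and] at hv hv'
    exact hij (hv.2.symm.trans hv'.2)
  have hunion := Finset.card_union_of_disjoint (hdisj _ _ kac)
  have hunion2 : (univ.filter fun v => {v} ∈ K ∧ κ v = κ a).card +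
      (univ.filter fun v => {v} ∈ K ∧ κ v = κ c).card ≤
      (univ.filter fun v => {v} ∈ K ∧ κ v ≠ κ b).card := by
    rw [← hunion]
    apply Finset.card_le_card
    intro v hv
    simp only [Finset.mem_union, Finset.mem_filter, Finset.mem_univ, true_and] at hv ⊢
    rcases hv with ⟨h1, h2⟩ | ⟨h1, h2⟩
    · exact ⟨h1, h2 ▸ kab⟩
    · exact ⟨h1, h2 ▸ kbc.symm⟩
  have hsplit : (univ.filter fun v => ({v} : Finset V) ∈ K ∧ κ v = κ b).card +
      (univ.filter fun v => {v} ∈ K ∧ κ v ≠ κ b).card =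
      (univ.filter fun v => ({v} : Finset V) ∈ K).card := by
    rw [← Finset.card_filter_add_card_filter_not (s := univ.filter fun v => ({v} : Finset V) ∈ K)
      (fun v => κ v = κ b), Finset.filter_filter, Finset.filter_filter]
  have hle : (univ.filter fun v => ({v} : Finset V) ∈ K).card ≤ fnum K 0 := by
    apply Finset.card_le_card_of_injOn (fun v => {v})
    · intro v hv
      simpa using hv
    · intro v _ w _ hvw
      exact Finset.singleton_injective hvw
  omega
end

section
/- Every balanced triangulation of the real projective plane RP² has at least 9 vertices, and there exists a balanced triangulation Δ^{RP²}_9 of RP² with f-vector (1, 9, 24, 16) attaining this bound. -/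
open Finset

variable {V : Type} [DecidableEq V] {W : Type} [DecidableEq W]

/-- Antipodal identification on the unit sphere in `ℝ³`. -/
def rpRel (x y : Metric.sphere (0 : EuclideanSpace ℝ (Fin 3)) 1) : Prop :=
  (x : EuclideanSpace ℝ (Fin 3)) = -(y : EuclideanSpace ℝ (Fin 3))

/-- The real projective plane, as the quotient of `S²` by the antipodal map. -/
noncomputable def RealProjPlane : Type := Quot rpRel

noncomputable instance : TopologicalSpace RealProjPlane := by unfold RealProjPlane; infer_instance

/-- A triangulation of `ℝP²`. -/
def IsRP2Tri {V : Type} [DecidableEq V] [Fintype V] (K : Finset (Finset V)) : Prop :=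
  IsCplx K ∧ Nonempty (geomReal K ≃ₜ RealProjPlane)


namespace RP2

abbrev E3 := EuclideanSpace ℝ (Fin 3)
abbrev S2 := Metric.sphere (0 : E3) 1

/-- The quotient map from the sphere. -/
def q (x : S2) : RealProjPlane := Quot.mk rpRel x

lemma q_quot : Topology.IsQuotientMap q := isQuotientMap_quot_mk

lemma q_neg (x : S2) : q (-x) = q x := Quot.sound (by simp [rpRel])

lemma q_eq_iff {x y : S2} : q x = q y ↔ x = y ∨ x = -y := by
  constructor
  · intro h
    have h' := Quot.eqvGen_exact h
    clear h
    induction h' with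
    | rel x y h => right; exact Subtype.ext h
    | refl x => left; rfl
    | symm x y _ ih => rcases ih with rfl | rfl <;> simp
    | trans x y z _ _ ih1 ih2 => rcases ih1 with rfl | rfl <;> rcases ih2 with rfl | rfl <;> simp
  · rintro (rfl | rfl)
    · rfl
    · exact q_neg y

lemma ne_neg (x : S2) : x ≠ -x := by
  intro h
  have h1 : (x : E3) = -(x : E3) := congrArg Subtype.val h
  have h2 : (x : E3) = 0 := by
    ext i
    have h3 := congrArg (fun v : E3 => v i) h1
    simp only [PiLp.neg_apply, PiLp.zero_apply] at h3 ⊢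
    linarith
  have := x.2
  rw [h2] at this
  simp at this

instance : CompactSpace RealProjPlane := by
  have : CompactSpace S2 := inferInstance
  exact (inferInstance : CompactSpace (Quot rpRel))

noncomputable instance actS2 : MulAction ℤˣ S2 where
  smul u x := if u = 1 then x else -x
  one_smul x := if_pos rfl
  mul_smul u v x := by
    change (if u * v = 1 then x else -x) = (if u = 1 then (if v = 1 then x else -x)
      else -(if v = 1 then x else -x))
    rcases Int.units_eq_one_or u with rfl | rfl <;> rcases Int.units_eq_one_or v with rfl | rfl <;>
      simp

lemma smul_def (u : ℤˣ) (x : S2) : u • x = if u = 1 then x else -x := rfl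

lemma q_cov : IsCoveringMap q := by
  have : IsQuotientCoveringMap q ℤˣ :=
    { q_quot with
      continuous_const_smul := by
        intro u
        simp only [smul_def]
        split_ifs
        · exact continuous_id
        · exact continuous_neg
      apply_eq_iff_mem_orbit := by
        intro x y
        rw [q_eq_iff]
        constructor
        · rintro (rfl | rfl)
          · exact MulAction.mem_orbit_self _
          · exact ⟨-1, by simp [smul_def]⟩
        · rintro ⟨u, rfl⟩
          simp only [smul_def]
          split_ifs <;> simp
      disjoint := by
        intro x
        refine ⟨{y : S2 | 0 < inner ℝ (x : E3) (y : E3)}, ?_, ?_⟩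
        · apply IsOpen.mem_nhds
          · exact isOpen_lt continuous_const (by fun_prop)
          · simp
        · rintro u ⟨_, ⟨y, hy, rfl⟩, hz⟩
          by_contra hu
          simp [smul_def, hu] at hy hz
          linarith }
  exact this.isCoveringMap

/-- lifting contractions -/
lemma exists_section {A : Type*} [TopologicalSpace A] (Φ : C(unitInterval × A, RealProjPlane))
    (p0 : RealProjPlane) (h0 : ∀ a, Φ (0, a) = p0) :
    ∃ s : A → S2, Continuous s ∧ ∀ a, q (s a) = Φ (1, a) := by
  obtain ⟨e0, rfl⟩ := q_quot.surjective p0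
  refine ⟨fun a => q_cov.liftHomotopy Φ (.const A e0) (fun a => h0 a) (1, a), ?_, ?_⟩
  · exact (ContinuousMap.continuous _).comp (by fun_prop)
  · intro a
    exact congrFun (q_cov.liftHomotopy_lifts Φ (.const A e0) (fun a => h0 a)) (1, a)

/-- upper hemisphere -/
noncomputable def hemi (z : Metric.closedBall (0 : ℂ) 1) : S2 :=
  ⟨!₂[(z : ℂ).re, (z : ℂ).im, Real.sqrt (1 - ‖(z : ℂ)‖ ^ 2)], by
    have hz : ‖(z : ℂ)‖ ≤ 1 := mem_closedBall_zero_iff.mp z.2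
    have h0 := norm_nonneg (z : ℂ)
    simp [EuclideanSpace.norm_eq, Fin.sum_univ_three]
    rw [Real.sq_sqrt (by nlinarith), Complex.sq_norm, Complex.normSq_apply]
    ring⟩

lemma hemi_cont : Continuous hemi := by
  unfold hemi
  apply Continuous.subtype_mk
  refine (PiLp.continuous_toLp 2 _).comp ?_
  refine continuous_pi fun i => ?_
  fin_cases i <;> simp <;> fun_prop

/-- Borsuk–Ulam in dimension two. -/
theorem borsuk_ulam (g : S2 → ℂ) (hg : Continuous g) (hodd : ∀ x, g (-x) = -g x) :
    ∃ x, g x = 0 := by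
  by_contra! hne
  let D := Metric.closedBall (0 : ℂ) 1
  have cov := Complex.isCoveringMap_exp
  let sc : unitInterval × D → D := fun p => ⟨(p.1 : ℝ) • (p.2 : ℂ), by
    have h1 : ‖(p.2 : ℂ)‖ ≤ 1 := mem_closedBall_zero_iff.mp p.2.2
    have h2 := p.1.2.1
    have h3 := p.1.2.2
    have h4 := norm_nonneg (p.2 : ℂ)
    simp only [Metric.mem_closedBall, dist_zero_right, norm_smul, Real.norm_eq_abs, abs_of_nonneg h2, D]
    nlinarith⟩
  have hsc : Continuous sc := by
    apply Continuous.subtype_mk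
    fun_prop
  let H : C(unitInterval × D, {z : ℂ // z ≠ 0}) :=
    ⟨fun p => ⟨g (hemi (sc p)), hne _⟩, by
      apply Continuous.subtype_mk
      exact hg.comp (hemi_cont.comp hsc)⟩
  let z0 : D := ⟨0, by simp [D]⟩
  have hs0 : ∀ a, sc (0, a) = z0 := fun a => Subtype.ext (by simp [sc, z0])
  have hs1 : ∀ a, sc (1, a) = a := fun a => Subtype.ext (by simp [sc])
  have H0 : ∀ a, H (0, a) = ⟨_, Complex.exp_ne_zero ((ContinuousMap.const D (Complex.log (g (hemi z0)))) a)⟩ := by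
    intro a
    apply Subtype.ext
    simp [H, hs0, Complex.exp_log (hne _)]
  let L := cov.liftHomotopy H (.const D (Complex.log (g (hemi z0)))) H0
  have hL : ∀ z : D, Complex.exp (L (1, z)) = g (hemi z) := by
    intro z
    have := congrFun (cov.liftHomotopy_lifts H (.const D (Complex.log (g (hemi z0)))) H0) (1, z)
    have := congrArg Subtype.val this
    have h2 : (H (1, z)).1 = g (hemi z) := by simp [H, hs1]
    rw [← h2]
    exact this
  let c : ℝ → D := fun θ => ⟨Complex.exp (θ * Complex.I), by
    simp [D, Complex.norm_exp_ofReal_mul_I]⟩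
  have hc : Continuous c := by
    apply Continuous.subtype_mk
    fun_prop
  have hcpi : ∀ θ, hemi (c (θ + Real.pi)) = - hemi (c θ) := by
    intro θ
    apply Subtype.ext
    ext i
    have : Complex.exp ((θ + Real.pi) * Complex.I) = - Complex.exp (θ * Complex.I) := by
      rw [add_mul, Complex.exp_add, Complex.exp_pi_mul_I]; ring
    fin_cases i <;> simp [hemi, c, this, Complex.norm_exp_ofReal_mul_I]
  have hc2 : c (0 + Real.pi + Real.pi) = c 0 := by
    apply Subtype.ext
    simp [c, add_mul, Complex.exp_add]
  let r : ℝ → ℝ := fun θ => (L (1, c (θ + Real.pi)) - L (1, c θ)).im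
  have hr : Continuous r := by
    apply Complex.continuous_im.comp
    apply Continuous.sub
    · exact L.continuous.comp (by fun_prop)
    · exact L.continuous.comp (by fun_prop)
  have hrpi : r (0 + Real.pi) = - r 0 := by
    simp only [r]
    rw [hc2]; simp
  obtain ⟨θ, hθ⟩ : ∃ θ, r θ = 0 := by
    apply mem_range_of_exists_le_of_exists_ge hr
    · rcases le_total (r 0) 0 with h | h
      · exact ⟨0, h⟩
      · exact ⟨0 + Real.pi, by linarith⟩
    · rcases le_total (r 0) 0 with h | h
      · exact ⟨0 + Real.pi, by linarith⟩
      · exact ⟨0, h⟩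
  have hexp : Complex.exp (L (1, c (θ + Real.pi)) - L (1, c θ)) = -1 := by
    rw [Complex.exp_sub, hL, hL, hcpi, hodd, neg_div, div_self (hne _)]
  have hre := congrArg Complex.re hexp
  rw [Complex.exp_re] at hre
  have : (L (1, c (θ + Real.pi)) - L (1, c θ)).im = 0 := hθ
  rw [this] at hre
  simp at hre
  have := Real.exp_pos ((L (1, c (θ + Real.pi))).re - (L (1, c θ)).re)
  linarith

/-- Lusternik–Schnirelmann type statement. -/
lemma ls_cover (A B : Set S2) (hA : IsClosed A) (hB : IsClosed B)
    (hA' : ∀ x ∈ A, -x ∉ A) (hB' : ∀ x ∈ B, -x ∉ B)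
    (hcov : ∀ x, x ∈ A ∨ -x ∈ A ∨ x ∈ B ∨ -x ∈ B) : False := by
  have key : ∀ C : Set S2, IsClosed C → (∀ x ∈ C, -x ∉ C) → ∀ x, (x ∈ C ∨ -x ∈ C) →
      Metric.infDist x C - Metric.infDist (-x) C ≠ 0 := by
    intro C hC hC' x hx h
    rcases hx with hx | hx
    · have h1 := Metric.infDist_zero_of_mem hx
      have h2 := (hC.mem_iff_infDist_zero ⟨x, hx⟩ (x := -x)).not.mp (hC' x hx)
      apply h2; linarith
    · have h1 := Metric.infDist_zero_of_mem hx
      have h2 := (hC.mem_iff_infDist_zero ⟨-x, hx⟩ (x := x)).not.mp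
        (by have := hC' (-x) hx; simpa using this)
      apply h2; linarith
  obtain ⟨x, hx⟩ := borsuk_ulam
    (fun x => ⟨Metric.infDist x A - Metric.infDist (-x) A,
      Metric.infDist x B - Metric.infDist (-x) B⟩)
    (by
      have h : ∀ C : Set S2, Continuous fun x : S2 => Metric.infDist x C - Metric.infDist (-x) C :=
        fun C => (Metric.continuous_infDist_pt C).sub
          ((Metric.continuous_infDist_pt C).comp continuous_neg)
      have : Continuous fun x : S2 => Complex.equivRealProdCLM.symm
        (Metric.infDist x A - Metric.infDist (-x) A, Metric.infDist x B - Metric.infDist (-x) B) :=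
        Complex.equivRealProdCLM.symm.continuous.comp ((h A).prodMk (h B))
      exact this)
    (by intro x; apply Complex.ext <;> simp)
  have h1 := congrArg Complex.re hx
  have h2 := congrArg Complex.im hx
  simp only [Complex.zero_re, Complex.zero_im] at h1 h2
  rcases hcov x with h | h | h | h
  · exact key A hA hA' x (Or.inl h) h1
  · exact key A hA hA' x (Or.inr h) h1
  · exact key B hB hB' x (Or.inl h) h2
  · exact key B hB hB' x (Or.inr h) h2

/-- A nonempty open subset of the sphere has no continuous real function separating
all non-antipodal points. -/
lemma no_inj (U : Set S2) (hU : IsOpen U) (x0 : S2) (hx0 : x0 ∈ U) (k : U → ℝ)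
    (hk : Continuous k)
    (hinj : ∀ x y : U, k x = k y → (x : S2) = y ∨ (x : S2) = -(y : S2)) : False := by
  have hx0n : ‖(x0 : E3)‖ = 1 := mem_sphere_zero_iff_norm.mp x0.2
  have hx0ne : (x0 : E3) ≠ 0 := by
    intro h; rw [h] at hx0n; simp at hx0n
  obtain ⟨i, hi⟩ : ∃ i, (x0 : E3) i ≠ 0 := by
    by_contra! h
    exact hx0ne (by ext i; simpa using h i)
  -- normalisation
  let N : {y : E3 // y ≠ 0} → S2 := fun y => ⟨‖(y : E3)‖⁻¹ • (y : E3), by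
    have := norm_ne_zero_iff.mpr y.2
    simp [norm_smul, this]⟩
  have hN : Continuous N := by
    apply Continuous.subtype_mk
    have h1 : Continuous fun y : {y : E3 // y ≠ 0} => ‖(y : E3)‖⁻¹ :=
      Continuous.inv₀ (by fun_prop) (fun y => norm_ne_zero_iff.mpr y.2)
    exact h1.smul continuous_subtype_val
  have hNx0 : N ⟨x0, hx0ne⟩ = x0 := by
    apply Subtype.ext; simp [N, hx0n]
  have hopen : IsOpen (Subtype.val '' (N ⁻¹' U) : Set E3) :=
    (isOpen_compl_singleton (x := (0 : E3))).isOpenMap_subtype_val _ (hU.preimage hN)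
  obtain ⟨δ, hδ, hball⟩ := Metric.isOpen_iff.mp hopen x0 ⟨⟨x0, hx0ne⟩, by show N _ ∈ U; rw [hNx0]; exact hx0, rfl⟩
  let w : ℝ → E3 := fun θ => (δ / 4) • (Real.cos θ • EuclideanSpace.single (i + 1) (1 : ℝ) +
    Real.sin θ • EuclideanSpace.single (i + 2) (1 : ℝ))
  have hw : Continuous w := by fun_prop
  have hwn : ∀ θ, ‖w θ‖ < δ := by
    intro θ
    simp only [w, norm_smul]
    have h1 : ‖(Real.cos θ • EuclideanSpace.single (i + 1) (1 : ℝ) +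
      Real.sin θ • EuclideanSpace.single (i + 2) (1 : ℝ) : E3)‖ ≤ 2 := by
      refine (norm_add_le _ _).trans ?_
      simp only [norm_smul, PiLp.norm_single, norm_one, mul_one, Real.norm_eq_abs]
      have := Real.abs_cos_le_one θ
      have := Real.abs_sin_le_one θ
      linarith
    rw [Real.norm_eq_abs, abs_of_pos (by linarith)]
    nlinarith
  have hmem : ∀ θ, (x0 : E3) + w θ ∈ (Subtype.val '' (N ⁻¹' U) : Set E3) := by
    intro θ
    apply hball
    simpa using hwn θ
  have hne : ∀ θ, (x0 : E3) + w θ ≠ 0 := by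
    intro θ
    obtain ⟨y, _, hy⟩ := hmem θ
    rw [← hy]; exact y.2
  have hU' : ∀ θ, N ⟨(x0 : E3) + w θ, hne θ⟩ ∈ U := by
    intro θ
    obtain ⟨y, h, hy⟩ := hmem θ
    have : y = ⟨(x0 : E3) + w θ, hne θ⟩ := Subtype.ext hy
    rw [← this]; exact h
  let c : ℝ → U := fun θ => ⟨N ⟨(x0 : E3) + w θ, hne θ⟩, hU' θ⟩
  have hc : Continuous c := by
    apply Continuous.subtype_mk
    exact hN.comp (Continuous.subtype_mk (by fun_prop) _)
  let r : ℝ → ℝ := fun θ => k (c (θ + Real.pi)) - k (c θ)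
  have hr : Continuous r := by fun_prop
  have hwpi : ∀ θ, w (θ + Real.pi) = - w θ := by
    intro θ
    simp only [w, Real.cos_add_pi, Real.sin_add_pi]
    module
  have hcpi : c (0 + Real.pi + Real.pi) = c 0 := by
    apply Subtype.ext
    simp only [c]
    congr 2
    rw [hwpi, hwpi, neg_neg]
  have hrpi : r (0 + Real.pi) = - r 0 := by
    simp only [r, hcpi]; ring
  obtain ⟨θ, hθ⟩ : ∃ θ, r θ = 0 := by
    apply mem_range_of_exists_le_of_exists_ge hr
    · rcases le_total (r 0) 0 with h | h
      · exact ⟨0, h⟩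
      · exact ⟨0 + Real.pi, by linarith⟩
    · rcases le_total (r 0) 0 with h | h
      · exact ⟨0 + Real.pi, by linarith⟩
      · exact ⟨0, h⟩
  have hkk : k (c (θ + Real.pi)) = k (c θ) := by
    have : k (c (θ + Real.pi)) - k (c θ) = 0 := hθ
    linarith
  have hα : 0 < ‖(x0 : E3) + w (θ + Real.pi)‖⁻¹ := inv_pos.mpr (norm_pos_iff.mpr (hne _))
  have hβ : 0 < ‖(x0 : E3) + w θ‖⁻¹ := inv_pos.mpr (norm_pos_iff.mpr (hne _))
  have hcv : ∀ θ, ((c θ : S2) : E3) = ‖(x0 : E3) + w θ‖⁻¹ • ((x0 : E3) + w θ) := fun θ => rfl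
  have i1 : i ≠ i + 1 := by fin_cases i <;> decide
  have i2 : i ≠ i + 2 := by fin_cases i <;> decide
  have i3 : i + 1 ≠ i + 2 := by fin_cases i <;> decide
  have hwi : ∀ θ, w θ i = 0 := by
    intro θ
    simp [w, i1, i2]
  have hw1 : ∀ θ, w θ (i + 1) = δ / 4 * Real.cos θ := by
    intro θ
    simp [w, i3]
  have hw2 : ∀ θ, w θ (i + 2) = δ / 4 * Real.sin θ := by
    intro θ
    simp [w, i3.symm]
  have hcs := Real.sin_sq_add_cos_sq θ
  rcases hinj _ _ hkk with h | h
  · have h' : ((c (θ + Real.pi) : S2) : E3) = ((c θ : S2) : E3) := congrArg Subtype.val h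
    rw [hcv, hcv, hwpi] at h'
    rw [hwpi] at hα
    generalize ‖(x0 : E3) + -w θ‖⁻¹ = α at *
    generalize ‖(x0 : E3) + w θ‖⁻¹ = β at *
    have e0 := congrArg (fun v : E3 => v i) h'
    have e1 := congrArg (fun v : E3 => v (i + 1)) h'
    have e2 := congrArg (fun v : E3 => v (i + 2)) h'
    simp only [PiLp.smul_apply, PiLp.add_apply, PiLp.neg_apply, hwi, hw1, hw2, smul_eq_mul] at e0 e1 e2
    have hab : α = β := by
      apply mul_right_cancel₀ hi
      linarith
    subst hab
    have f1 : Real.cos θ = 0 := by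
      have : (α * δ) * Real.cos θ = 0 := by linarith
      exact (mul_eq_zero.mp this).resolve_left (mul_pos hα hδ).ne'
    have f2 : Real.sin θ = 0 := by
      have : (α * δ) * Real.sin θ = 0 := by linarith
      exact (mul_eq_zero.mp this).resolve_left (mul_pos hα hδ).ne'
    rw [f1, f2] at hcs
    norm_num at hcs
  · have h' : ((c (θ + Real.pi) : S2) : E3) = -((c θ : S2) : E3) := congrArg Subtype.val h
    rw [hcv, hcv, hwpi] at h'
    rw [hwpi] at hα
    generalize ‖(x0 : E3) + -w θ‖⁻¹ = α at *
    generalize ‖(x0 : E3) + w θ‖⁻¹ = β at *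
    have e0 := congrArg (fun v : E3 => v i) h'
    simp only [PiLp.smul_apply, PiLp.add_apply, PiLp.neg_apply, hwi, smul_eq_mul] at e0
    have : (α + β) * (x0 : E3) i = 0 := by linarith
    rcases mul_eq_zero.mp this with h | h
    · linarith
    · exact hi h

section lower

variable {n : ℕ} {K : Finset (Finset (Fin n))}

lemma mem_geom (hK : IsCplx K) {f : Fin n → ℝ} (h0 : ∀ v, 0 ≤ f v) (h1 : ∑ v, f v = 1)
    {F : Finset (Fin n)} (hF : F ∈ K) (hs : ∀ v, f v ≠ 0 → v ∈ F) : f ∈ geomReal K := by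
  refine ⟨h0, h1, univ.filter (fun v => f v ≠ 0), ?_, by simp⟩
  apply hK.2 F hF
  · intro v hv
    exact hs v (by simpa using hv)
  · intro h
    have : ∀ v, f v = 0 := by
      intro v
      by_contra hv
      have : v ∈ univ.filter (fun v => f v ≠ 0) := by simpa using hv
      rw [h] at this
      simp at this
    simp [this] at h1

/-- the closed star of a vertex -/
def star' (K : Finset (Finset (Fin n))) (a : Fin n) : Set (geomReal K) :=
  {f | ∃ F ∈ K, a ∈ F ∧ ∀ v, (f : Fin n → ℝ) v ≠ 0 → v ∈ F}

lemma star_closed (a : Fin n) : IsClosed (star' K a) := by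
  have : star' K a = ⋃ F ∈ K.filter (fun F => a ∈ F),
      ⋂ v ∈ univ.filter (fun v => v ∉ F), {f : geomReal K | (f : Fin n → ℝ) v = 0} := by
    ext f
    simp only [star', Set.mem_ofPred_eq, Finset.mem_filter, Set.mem_iUnion, Set.mem_iInter,
      Finset.mem_univ, true_and, exists_prop]
    constructor
    · rintro ⟨F, hF, ha, h⟩
      exact ⟨F, ⟨hF, ha⟩, fun v hv => by_contra fun h' => hv (h v h')⟩
    · rintro ⟨F, ⟨hF, ha⟩, h⟩
      exact ⟨F, hF, ha, fun v hv => by_contra fun h' => hv (h v h')⟩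
  rw [this]
  apply Set.Finite.isClosed_biUnion (Finset.finite_toSet _)
  intro F _
  apply isClosed_biInter
  intro v _
  exact isClosed_eq ((continuous_apply v).comp continuous_subtype_val) continuous_const

/-- the straight line contraction of the star -/
noncomputable def contr (hK : IsCplx K) (a : Fin n) (p : unitInterval × star' K a) : geomReal K :=
  ⟨(1 - (p.1 : ℝ)) • Pi.single a (1 : ℝ) + (p.1 : ℝ) • (p.2.1 : Fin n → ℝ), by
    obtain ⟨t, ⟨f, hf⟩, F, hF, ha, hs⟩ := p
    have t0 := t.2.1
    have t1 := t.2.2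
    refine mem_geom hK ?_ ?_ hF ?_
    · intro v
      have h1 : 0 ≤ (Pi.single a (1 : ℝ) : Fin n → ℝ) v := by
        by_cases h : v = a
        · subst h; simp
        · simp [h]
      have h2 := hf.1 v
      simp only [Pi.add_apply, Pi.smul_apply, smul_eq_mul]
      have := mul_nonneg (sub_nonneg.mpr t1) h1
      have := mul_nonneg t0 h2
      linarith
    · simp only [Pi.add_apply, Pi.smul_apply, smul_eq_mul, Finset.sum_add_distrib,
        ← Finset.mul_sum, hf.2.1]
      simp
    · intro v hv
      by_contra hvF
      have h1 : f v = 0 := by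
        by_contra h; exact hvF (hs v h)
      have h2 : v ≠ a := by rintro rfl; exact hvF ha
      apply hv
      simp [h1, h2]⟩

lemma contr_cont (hK : IsCplx K) (a : Fin n) : Continuous (contr hK a) := by
  apply Continuous.subtype_mk
  fun_prop

lemma star_lift (hK : IsCplx K) (e : geomReal K ≃ₜ RealProjPlane) (a : Fin n) (ha : {a} ∈ K) :
    ∃ C : Set S2, IsClosed C ∧ (∀ x ∈ C, -x ∉ C) ∧
      ∀ x, e.symm (q x) ∈ star' K a → x ∈ C ∨ -x ∈ C := by
  have hp : (Pi.single a (1 : ℝ) : Fin n → ℝ) ∈ geomReal K := by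
    refine mem_geom hK ?_ ?_ ha ?_
    · intro v
      by_cases h : v = a
      · subst h; simp
      · simp [h]
    · simp
    · intro v hv
      by_contra h
      simp at h
      simp [h] at hv
  obtain ⟨s, hs, hsq⟩ := exists_section (A := star' K a)
    ⟨fun p => e (contr hK a p), e.continuous.comp (contr_cont hK a)⟩ (e ⟨_, hp⟩) (by
      intro f
      simp only [ContinuousMap.coe_mk]
      congr 1
      apply Subtype.ext
      simp [contr])
  have hsq' : ∀ f, q (s f) = e f.1 := by
    intro f
    rw [hsq]
    simp only [ContinuousMap.coe_mk]
    congr 1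
    apply Subtype.ext
    simp [contr]
  have : CompactSpace (geomReal K) := e.symm.compactSpace
  have : CompactSpace (star' K a) := isCompact_iff_compactSpace.mp (star_closed a).isCompact
  refine ⟨Set.range s, (isCompact_range hs).isClosed, ?_, ?_⟩
  · rintro _ ⟨f, rfl⟩ ⟨g, hg⟩
    have h1 : q (s g) = q (s f) := by rw [hg, q_neg]
    rw [hsq', hsq'] at h1
    have h2 : g = f := Subtype.ext (e.injective h1)
    rw [h2] at hg
    exact ne_neg _ hg
  · intro x hx
    have h := hsq' ⟨_, hx⟩
    simp only [Homeomorph.apply_symm_apply] at h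
    rcases q_eq_iff.mp h with h | h
    · left; exact ⟨_, h⟩
    · right; exact ⟨_, h⟩

/-- every maximal face meets every colour -/
lemma pure_color (hK : IsCplx K) (e : geomReal K ≃ₜ RealProjPlane) (κ : Fin n → Fin 3)
    (hκ : ProperColoring 2 K κ) (c : Fin 3) (F : Finset (Fin n)) (hF : F ∈ K)
    (hmax : ∀ G ∈ K, F ⊆ G → G = F) : ∃ v ∈ F, κ v = c := by
  by_contra! hc
  have hFne : F.Nonempty := by
    rw [Finset.nonempty_iff_ne_empty]; rintro rfl; exact hK.1 hF
  obtain ⟨v0, hv0⟩ := hFne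
  have hcard : (F.erase v0).card ≤ 1 := by
    have h1 : F.card ≤ ((univ : Finset (Fin 3)).erase c).card := by
      apply Finset.card_le_card_of_injOn κ
      · intro v hv
        simpa using hc v hv
      · exact hκ F hF
    rw [Finset.card_erase_of_mem hv0]
    simp at h1
    omega
  let O : Set (geomReal K) := {f | ∀ v ∈ F, (f : Fin n → ℝ) v ≠ 0}
  have hO : IsOpen O := by
    have : O = ⋂ v ∈ F, {f : geomReal K | (f : Fin n → ℝ) v ≠ 0} := by
      ext f; simp [O]
    rw [this]
    apply isOpen_biInter_finset
    intro v _
    exact isOpen_ne_fun ((continuous_apply v).comp continuous_subtype_val) continuous_const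
  have hOF : ∀ f ∈ O, ∀ v, (f : Fin n → ℝ) v ≠ 0 → v ∈ F := by
    rintro ⟨f, h0, h1, G, hG, hGs⟩ hf v hv
    have h2 : G = F := by
      apply hmax G hG
      intro u hu
      have : u ∈ {v | f v ≠ 0} := hf u hu
      rw [hGs] at this
      simpa using this
    have : v ∈ {v | f v ≠ 0} := hv
    rw [hGs, h2] at this
    simpa using this
  have hinj : ∀ f ∈ O, ∀ g ∈ O, (f : Fin n → ℝ) v0 = (g : Fin n → ℝ) v0 → f = g := by
    intro f hf g hg h
    have hsum : ∀ f ∈ O, (f : Fin n → ℝ) v0 + ∑ v ∈ F.erase v0, (f : Fin n → ℝ) v = 1 := by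
      intro f hf
      rw [Finset.add_sum_erase _ _ hv0, ← f.2.2.1]
      apply Finset.sum_subset (Finset.subset_univ _)
      intro v _ hv
      by_contra h
      exact hv (hOF f hf v h)
    apply Subtype.ext
    funext v
    by_cases hv : v ∈ F
    · by_cases hv' : v = v0
      · rw [hv']; exact h
      · have hE : F.erase v0 = {v} := by
          apply (Finset.eq_of_subset_of_card_le _ (by simpa using hcard)).symm
          simp [hv, hv']
        have e1 := hsum f hf
        have e2 := hsum g hg
        rw [hE] at e1 e2
        simp at e1 e2
        linarith
    · have h1 : (f : Fin n → ℝ) v = 0 := by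
        by_contra h; exact hv (hOF f hf v h)
      have h2 : (g : Fin n → ℝ) v = 0 := by
        by_contra h; exact hv (hOF g hg v h)
      rw [h1, h2]
  -- the barycenter
  have hFc : (0 : ℝ) < F.card := by exact_mod_cast Finset.card_pos.mpr ⟨v0, hv0⟩
  have hb : (fun v => if v ∈ F then (F.card : ℝ)⁻¹ else 0) ∈ geomReal K := by
    refine mem_geom hK ?_ ?_ hF ?_
    · intro v
      split_ifs
      · positivity
      · exact le_rfl
    · simp [hFc.ne']
    · intro v hv
      by_contra h
      simp [h] at hv
  obtain ⟨x0, hx0⟩ := q_quot.surjective (e ⟨_, hb⟩)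
  refine no_inj ((fun x => e.symm (q x)) ⁻¹' O)
    (hO.preimage (e.symm.continuous.comp q_quot.continuous)) x0 ?_
    (fun x => (e.symm (q x.1) : Fin n → ℝ) v0) ?_ ?_
  · simp only [Set.mem_preimage, hx0, Homeomorph.symm_apply_apply, O, Set.mem_ofPred_eq]
    intro v hv
    simp [hv, hFc.ne']
  · exact (continuous_apply v0).comp (continuous_subtype_val.comp
      (e.symm.continuous.comp (q_quot.continuous.comp continuous_subtype_val)))
  · intro x y hxy
    have := hinj _ x.2 _ y.2 hxy
    exact q_eq_iff.mp (e.symm.injective this)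

lemma exists_max {F : Finset (Fin n)} (hF : F ∈ K) :
    ∃ G ∈ K, F ⊆ G ∧ ∀ H ∈ K, G ⊆ H → H = G := by
  obtain ⟨G, hFG, hG⟩ := Finset.exists_le_maximal K hF
  exact ⟨G, hG.1, hFG, fun H hH hGH => le_antisymm (hG.2 hH hGH) hGH⟩

theorem color_class (hK : IsCplx K) (e : geomReal K ≃ₜ RealProjPlane) (κ : Fin n → Fin 3)
    (hκ : ProperColoring 2 K κ) (c : Fin 3) :
    3 ≤ (univ.filter fun v => {v} ∈ K ∧ κ v = c).card := by
  set S := univ.filter fun v => {v} ∈ K ∧ κ v = c with hS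
  by_contra! hlt
  -- every point lies in the star of some vertex of colour c
  have hstar : ∀ f : geomReal K, ∃ a ∈ S, f ∈ star' K a := by
    rintro ⟨f, h0, h1, F, hF, hs⟩
    obtain ⟨G, hG, hFG, hmax⟩ := exists_max hF
    obtain ⟨a, ha, hac⟩ := pure_color hK e κ hκ c G hG hmax
    refine ⟨a, ?_, G, hG, ha, ?_⟩
    · simp only [hS, Finset.mem_filter, Finset.mem_univ, true_and]
      exact ⟨hK.2 G hG {a} (by simpa using ha) (by simp), hac⟩
    · intro v hv
      have : v ∈ {v | f v ≠ 0} := hv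
      rw [hs] at this
      exact hFG (by simpa using this)
  have x0 : S2 := hemi ⟨0, by simp⟩
  obtain ⟨a, haS, _⟩ := hstar (e.symm (q x0))
  obtain ⟨b, hbS, hab⟩ : ∃ b ∈ S, ∀ v ∈ S, v = a ∨ v = b := by
    have h2 : (S.erase a).card ≤ 1 := by
      rw [Finset.card_erase_of_mem haS]; omega
    rcases Finset.eq_empty_or_nonempty (S.erase a) with h | ⟨b, hb⟩
    · refine ⟨a, haS, fun v hv => Or.inl ?_⟩
      by_contra hva
      have : v ∈ S.erase a := Finset.mem_erase.mpr ⟨hva, hv⟩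
      rw [h] at this; simp at this
    · refine ⟨b, Finset.mem_of_mem_erase hb, fun v hv => ?_⟩
      by_cases hva : v = a
      · exact Or.inl hva
      · exact Or.inr (Finset.card_le_one.mp h2 v (Finset.mem_erase.mpr ⟨hva, hv⟩) b hb)
  obtain ⟨A, hA, hA', hA''⟩ := star_lift hK e a (Finset.mem_filter.mp haS).2.1
  obtain ⟨B, hB, hB', hB''⟩ := star_lift hK e b (Finset.mem_filter.mp hbS).2.1
  refine ls_cover A B hA hB hA' hB' fun x => ?_
  obtain ⟨v, hv, hx⟩ := hstar (e.symm (q x))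
  rcases hab v hv with rfl | rfl
  · rcases hA'' x hx with h | h <;> simp [h]
  · rcases hB'' x hx with h | h <;> simp [h]

theorem lower (hK : IsRP2Tri K) (hb : BalancedC 2 K) : 9 ≤ fnum K 0 := by
  obtain ⟨hc, ⟨e⟩⟩ := hK
  obtain ⟨κ, hκ⟩ := hb
  have h1 : fnum K 0 = (univ.filter fun v => {v} ∈ K).card := by
    unfold fnum
    rw [← Finset.card_image_of_injective (univ.filter fun v => {v} ∈ K)
      (Finset.singleton_injective)]
    congr 1
    ext F
    simp only [Finset.mem_filter, Finset.mem_image, Finset.mem_univ, true_and, zero_add,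
      Finset.card_eq_one]
    constructor
    · rintro ⟨hF, v, rfl⟩; exact ⟨v, hF, rfl⟩
    · rintro ⟨v, hv, rfl⟩; exact ⟨hv, v, rfl⟩
  rw [h1, Finset.card_eq_sum_card_fiberwise (f := κ) (t := univ) (by intro v _; simp)]
  simp only [Finset.filter_filter]
  calc 9 = ∑ c : Fin 3, 3 := by simp
    _ ≤ _ := Finset.sum_le_sum fun c _ => color_class hc e κ hκ c

end lower

section upper

noncomputable def cor (x y z : ℝ) : ℝ := max 0 (|x| - |y| - |z|)
noncomputable def mp (x y z : ℝ) : ℝ :=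
  max 0 (min ((|x + y| - |x - y|) / 2) ((|x| + |y| - |z|) / 2))

noncomputable def hat (x y z : ℝ) : Fin 9 → ℝ :=
  ![cor x y z, cor y x z, cor z x y, mp x y z, mp x (-y) z, mp x z y, mp x (-z) y,
    mp y z x, mp y (-z) x]

def tri : Finset (Finset (Fin 9)) :=
  {{0,3,5},{0,3,6},{0,4,5},{0,4,6},{1,3,7},{1,3,8},{1,4,7},{1,4,8},
   {2,5,7},{2,5,8},{2,6,7},{2,6,8},{3,5,7},{3,6,8},{4,5,8},{4,6,7}}

def K9 : Finset (Finset (Fin 9)) := (tri.biUnion Finset.powerset).erase ∅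

lemma K9_cplx : IsCplx K9 := by
  constructor
  · simp [K9]
  · intro F hF G hG hne
    simp only [K9, Finset.mem_erase, Finset.mem_biUnion, Finset.mem_powerset] at hF ⊢
    obtain ⟨_, T, hT, hFT⟩ := hF
    exact ⟨hne, T, hT, hG.trans hFT⟩

lemma K9_bal : BalancedC 2 K9 := by
  refine ⟨![0, 1, 2, 2, 2, 1, 1, 0, 0], ?_⟩
  have : ∀ F ∈ K9, ∀ a ∈ F, ∀ b ∈ F, (![0, 1, 2, 2, 2, 1, 1, 0, 0] : Fin 9 → Fin 3) a =
    (![0, 1, 2, 2, 2, 1, 1, 0, 0] : Fin 9 → Fin 3) b → a = b := by decide +kernel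
  intro F hF a ha b hb h
  exact this F hF a ha b hb h

lemma K9_f0 : fnum K9 0 = 9 := by decide +kernel
lemma K9_f1 : fnum K9 1 = 24 := by decide +kernel
lemma K9_f2 : fnum K9 2 = 16 := by decide +kernel

lemma cor_nonneg (x y z : ℝ) : 0 ≤ cor x y z := le_max_left _ _
lemma mp_nonneg (x y z : ℝ) : 0 ≤ mp x y z := le_max_left _ _

lemma hat_nonneg (x y z : ℝ) (v : Fin 9) : 0 ≤ hat x y z v := by
  fin_cases v <;> simp [hat, cor_nonneg, mp_nonneg]

/-- The unsigned midpoint hat function. -/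
noncomputable def mm (X Y Z : ℝ) : ℝ := max 0 (min (min X Y) ((X + Y - Z) / 2))

lemma mp_of_nonneg {x y : ℝ} (z : ℝ) (h : 0 ≤ x * y) : mp x y z = mm |x| |y| |z| := by
  unfold mp mm
  congr 2
  rcases le_total 0 x with hx | hx <;> rcases le_total 0 y with hy | hy
  · grind
  · have : x * y = 0 := le_antisymm (mul_nonpos_of_nonneg_of_nonpos hx hy) h
    rcases mul_eq_zero.mp this with rfl | rfl <;> simp
  · have : x * y = 0 := le_antisymm (mul_nonpos_of_nonpos_of_nonneg hx hy) h
    rcases mul_eq_zero.mp this with rfl | rfl <;> simp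
  · grind

lemma mp_of_nonpos {x y : ℝ} (z : ℝ) (h : x * y ≤ 0) : mp x y z = 0 := by
  have : |x + y| ≤ |x - y| := by
    apply sq_le_sq.mp
    nlinarith
  unfold mp
  apply max_eq_left
  exact (min_le_left _ _).trans (by linarith)

lemma mp_add (x y z : ℝ) : mp x y z + mp x (-y) z = mm |x| |y| |z| := by
  rcases le_total 0 (x * y) with h | h
  · rw [mp_of_nonneg z h, mp_of_nonpos (y := -y) z (by linarith)]; simp
  · rw [mp_of_nonpos z h, mp_of_nonneg (y := -y) z (by linarith)]; simp

lemma recover {X Y Z : ℝ} (hX : 0 ≤ X) (hY : 0 ≤ Y) (hZ : 0 ≤ Z) :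
    max 0 (X - Y - Z) + mm X Y Z + mm X Z Y = X := by
  unfold mm
  grind

lemma rec_x (x y z : ℝ) : |x| = hat x y z 0 + hat x y z 3 + hat x y z 4 + hat x y z 5
    + hat x y z 6 := by
  have h1 := mp_add x y z
  have h2 := mp_add x z y
  have h3 := recover (abs_nonneg x) (abs_nonneg y) (abs_nonneg z)
  simp [hat, cor]
  linarith

lemma mp_comm (x y z : ℝ) : mp x y z = mp y x z := by
  unfold mp
  rw [add_comm x y, abs_sub_comm x y, add_comm |x| |y|]

lemma mp_neg_neg (x y z : ℝ) : mp (-x) (-y) z = mp x y z := by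
  unfold mp
  rw [← neg_add, abs_neg, abs_neg, abs_neg, ← abs_neg (x - y)]
  congr 6
  ring

lemma mp_comm' (x y z : ℝ) : mp x (-y) z = mp y (-x) z := by
  rw [mp_comm, ← mp_neg_neg, neg_neg]

lemma rec_y (x y z : ℝ) : |y| = hat x y z 1 + hat x y z 3 + hat x y z 4 + hat x y z 7
    + hat x y z 8 := by
  have h1 := mp_add y x z
  have h2 := mp_add y z x
  have h3 := recover (abs_nonneg y) (abs_nonneg x) (abs_nonneg z)
  simp [hat, cor]
  rw [mp_comm x y, mp_comm' x y]
  linarith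

lemma rec_z (x y z : ℝ) : |z| = hat x y z 2 + hat x y z 5 + hat x y z 6 + hat x y z 7
    + hat x y z 8 := by
  have h1 := mp_add z x y
  have h2 := mp_add z y x
  have h3 := recover (abs_nonneg z) (abs_nonneg x) (abs_nonneg y)
  simp [hat, cor]
  rw [mp_comm x z, mp_comm' x z, mp_comm y z, mp_comm' y z]
  linarith

lemma hat_neg (x y z : ℝ) : hat (-x) (-y) (-z) = hat x y z := by
  have h1 : ∀ x y z, cor (-x) (-y) (-z) = cor x y z := by intro x y z; simp [cor]
  have h2 : ∀ x y z, mp (-x) (-y) (-z) = mp x y z := by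
    intro x y z; rw [mp_neg_neg]; simp [mp]
  simp only [hat, h1, h2]

lemma hat_smul {c : ℝ} (hc : 0 ≤ c) (x y z : ℝ) :
    hat (c * x) (c * y) (c * z) = c • hat x y z := by
  have h1 : ∀ x y z, cor (c * x) (c * y) (c * z) = c * cor x y z := by
    intro x y z
    simp only [cor, abs_mul, abs_of_nonneg hc, mul_max_of_nonneg _ _ hc]
    congr 1 <;> ring
  have h2 : ∀ x y z, mp (c * x) (c * y) (c * z) = c * mp x y z := by
    intro x y z
    simp only [mp, ← mul_add, ← mul_sub, abs_mul, abs_of_nonneg hc, mul_max_of_nonneg _ _ hc,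
      mul_min_of_nonneg _ _ hc]
    congr 1
    · ring
    · congr 1 <;> ring
  simp only [hat, ← mul_neg, h1, h2]
  ext v
  fin_cases v <;> simp

lemma mm_zero {X Y Z : ℝ} (h : X + Y ≤ Z) : mm X Y Z = 0 := by
  unfold mm
  apply max_eq_left
  exact (min_le_right _ _).trans (by linarith)

lemma mp_zero {x y z : ℝ} (h : |x| + |y| ≤ |z|) : mp x y z = 0 := by
  unfold mp
  apply max_eq_left
  exact (min_le_right _ _).trans (by linarith)

lemma cor_zero {x y z : ℝ} (h : |x| ≤ |y| + |z|) : cor x y z = 0 := by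
  unfold cor
  apply max_eq_left
  linarith

lemma support (g : Fin 9 → ℝ)
    (hA : (g 4 = 0 ∧ g 6 = 0 ∧ g 8 = 0) ∨ (g 4 = 0 ∧ g 5 = 0 ∧ g 7 = 0) ∨
      (g 3 = 0 ∧ g 6 = 0 ∧ g 7 = 0) ∨ (g 3 = 0 ∧ g 5 = 0 ∧ g 8 = 0))
    (hB : (g 1 = 0 ∧ g 2 = 0 ∧ g 7 = 0 ∧ g 8 = 0) ∨ (g 0 = 0 ∧ g 2 = 0 ∧ g 5 = 0 ∧ g 6 = 0) ∨
      (g 0 = 0 ∧ g 1 = 0 ∧ g 3 = 0 ∧ g 4 = 0) ∨ (g 0 = 0 ∧ g 1 = 0 ∧ g 2 = 0)) :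
    ∃ T ∈ tri, ∀ v, g v ≠ 0 → v ∈ T := by
  have fin : ∀ T ∈ tri, (∀ v ∈ Tᶜ, g v = 0) → ∃ T ∈ tri, ∀ v, g v ≠ 0 → v ∈ T := by
    intro T hT h
    refine ⟨T, hT, fun v hv => ?_⟩
    by_contra h'
    exact hv (h v (by simpa using h'))
  have c1 : ∀ a b c d e f : Fin 9, ∀ T ∈ tri, Tᶜ = {a, b, c, d, e, f} → g a = 0 → g b = 0 →
      g c = 0 → g d = 0 → g e = 0 → g f = 0 → ∃ T ∈ tri, ∀ v, g v ≠ 0 → v ∈ T := by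
    intro a b c d e f T hT hTc ha hb hc hd he hf
    apply fin T hT
    rw [hTc]
    simp [ha, hb, hc, hd, he, hf]
  rcases hA with ⟨a1, a2, a3⟩ | ⟨a1, a2, a3⟩ | ⟨a1, a2, a3⟩ | ⟨a1, a2, a3⟩
  · rcases hB with ⟨b1, b2, b3, b4⟩ | ⟨b1, b2, b3, b4⟩ | ⟨b1, b2, b3, b4⟩ | ⟨b1, b2, b3⟩
    · exact c1 1 2 7 8 4 6 {0,3,5} (by decide) (by decide) b1 b2 b3 b4 a1 a2
    · exact c1 0 2 5 6 4 8 {1,3,7} (by decide) (by decide) b1 b2 b3 b4 a1 a3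
    · exact c1 0 1 3 4 6 8 {2,5,7} (by decide) (by decide) b1 b2 b3 b4 a2 a3
    · exact c1 0 1 2 4 6 8 {3,5,7} (by decide) (by decide) b1 b2 b3 a1 a2 a3
  · rcases hB with ⟨b1, b2, b3, b4⟩ | ⟨b1, b2, b3, b4⟩ | ⟨b1, b2, b3, b4⟩ | ⟨b1, b2, b3⟩
    · exact c1 1 2 7 8 4 5 {0,3,6} (by decide) (by decide) b1 b2 b3 b4 a1 a2
    · exact c1 0 2 5 6 4 7 {1,3,8} (by decide) (by decide) b1 b2 b3 b4 a1 a3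
    · exact c1 0 1 3 4 5 7 {2,6,8} (by decide) (by decide) b1 b2 b3 b4 a2 a3
    · exact c1 0 1 2 4 5 7 {3,6,8} (by decide) (by decide) b1 b2 b3 a1 a2 a3
  · rcases hB with ⟨b1, b2, b3, b4⟩ | ⟨b1, b2, b3, b4⟩ | ⟨b1, b2, b3, b4⟩ | ⟨b1, b2, b3⟩
    · exact c1 1 2 7 8 3 6 {0,4,5} (by decide) (by decide) b1 b2 b3 b4 a1 a2
    · exact c1 0 2 5 6 3 7 {1,4,8} (by decide) (by decide) b1 b2 b3 b4 a1 a3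
    · exact c1 0 1 3 4 6 7 {2,5,8} (by decide) (by decide) b1 b2 b3 b4 a2 a3
    · exact c1 0 1 2 3 6 7 {4,5,8} (by decide) (by decide) b1 b2 b3 a1 a2 a3
  · rcases hB with ⟨b1, b2, b3, b4⟩ | ⟨b1, b2, b3, b4⟩ | ⟨b1, b2, b3, b4⟩ | ⟨b1, b2, b3⟩
    · exact c1 1 2 7 8 3 5 {0,4,6} (by decide) (by decide) b1 b2 b3 b4 a1 a2
    · exact c1 0 2 5 6 3 8 {1,4,7} (by decide) (by decide) b1 b2 b3 b4 a1 a3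
    · exact c1 0 1 3 4 5 8 {2,6,7} (by decide) (by decide) b1 b2 b3 b4 a2 a3
    · exact c1 0 1 2 3 5 8 {4,6,7} (by decide) (by decide) b1 b2 b3 a1 a2 a3

lemma hat_support (x y z : ℝ) : ∃ T ∈ tri, ∀ v, hat x y z v ≠ 0 → v ∈ T := by
  apply support
  · have P : ∀ {a b : ℝ} (c : ℝ), 0 ≤ a * b → mp a (-b) c = 0 := by
      intro a b c h; exact mp_of_nonpos c (by linarith)
    have N : ∀ {a b : ℝ} (c : ℝ), a * b ≤ 0 → mp a b c = 0 := fun c h => mp_of_nonpos c h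
    simp only [hat, Matrix.cons_val]
    rcases le_total 0 x with hx | hx <;> rcases le_total 0 y with hy | hy <;>
      rcases le_total 0 z with hz | hz
    · exact Or.inl ⟨P _ (mul_nonneg hx hy), P _ (mul_nonneg hx hz), P _ (mul_nonneg hy hz)⟩
    · exact Or.inr (Or.inl ⟨P _ (mul_nonneg hx hy), N _ (mul_nonpos_of_nonneg_of_nonpos hx hz), N _ (mul_nonpos_of_nonneg_of_nonpos hy hz)⟩)
    · exact Or.inr (Or.inr (Or.inl ⟨N _ (mul_nonpos_of_nonneg_of_nonpos hx hy), P _ (mul_nonneg hx hz), N _ (mul_nonpos_of_nonpos_of_nonneg hy hz)⟩))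
    · exact Or.inr (Or.inr (Or.inr ⟨N _ (mul_nonpos_of_nonneg_of_nonpos hx hy), N _ (mul_nonpos_of_nonneg_of_nonpos hx hz), P _ (mul_nonneg_of_nonpos_of_nonpos hy hz)⟩))
    · exact Or.inr (Or.inr (Or.inr ⟨N _ (mul_nonpos_of_nonpos_of_nonneg hx hy), N _ (mul_nonpos_of_nonpos_of_nonneg hx hz), P _ (mul_nonneg hy hz)⟩))
    · exact Or.inr (Or.inr (Or.inl ⟨N _ (mul_nonpos_of_nonpos_of_nonneg hx hy), P _ (mul_nonneg_of_nonpos_of_nonpos hx hz), N _ (mul_nonpos_of_nonneg_of_nonpos hy hz)⟩))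
    · exact Or.inr (Or.inl ⟨P _ (mul_nonneg_of_nonpos_of_nonpos hx hy), N _ (mul_nonpos_of_nonpos_of_nonneg hx hz), N _ (mul_nonpos_of_nonpos_of_nonneg hy hz)⟩)
    · exact Or.inl ⟨P _ (mul_nonneg_of_nonpos_of_nonpos hx hy), P _ (mul_nonneg_of_nonpos_of_nonpos hx hz), P _ (mul_nonneg_of_nonpos_of_nonpos hy hz)⟩
  · have hx := abs_nonneg x
    have hy := abs_nonneg y
    have hz := abs_nonneg z
    simp only [hat, Matrix.cons_val]
    by_cases h1 : |y| + |z| ≤ |x|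
    · exact Or.inl ⟨cor_zero (by linarith), cor_zero (by linarith), mp_zero h1,
        mp_zero (by simpa using h1)⟩
    by_cases h2 : |x| + |z| ≤ |y|
    · exact Or.inr (Or.inl ⟨cor_zero (by linarith), cor_zero (by linarith), mp_zero h2,
        mp_zero (by simpa using h2)⟩)
    by_cases h3 : |x| + |y| ≤ |z|
    · exact Or.inr (Or.inr (Or.inl ⟨cor_zero (by linarith), cor_zero (by linarith), mp_zero h3,
        mp_zero (by simpa using h3)⟩))
    · exact Or.inr (Or.inr (Or.inr ⟨cor_zero (by linarith), cor_zero (by linarith),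
        cor_zero (by linarith)⟩))

/-- If two midpoint coordinates do not determine the sign of `z`, then it does not matter. -/
lemma sign_lemma {x y z : ℝ} (h1 : mp x z y = mp x (-z) y) (h2 : mp y z x = mp y (-z) x) :
    z = 0 ∨ (x = 0 ∧ y = 0) := by
  have key : ∀ {x y z : ℝ}, mp x z y = mp x (-z) y → mm |x| |z| |y| = 0 := by
    intro x y z h
    have := mp_add x z y
    rcases le_total 0 (x * z) with h' | h'
    · have := mp_of_nonpos (x := x) (y := -z) y (by linarith)
      linarith
    · have := mp_of_nonpos (x := x) (y := z) y (by linarith)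
      linarith
  have k1 := key h1
  have k2 := key h2
  have hx := abs_nonneg x
  have hy := abs_nonneg y
  have hz := abs_nonneg z
  rw [← abs_eq_zero, ← abs_eq_zero (a := x), ← abs_eq_zero (a := y)]
  generalize |x| = X at *
  generalize |y| = Y at *
  generalize |z| = Z at *
  unfold mm at k1 k2
  grind

lemma hat_inj {x y z x' y' z' : ℝ} (h : hat x y z = hat x' y' z') :
    (x = x' ∧ y = y' ∧ z = z') ∨ (x = -x' ∧ y = -y' ∧ z = -z') := by
  have hx : |x| = |x'| := by rw [rec_x x y z, rec_x x' y' z', h]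
  have hy : |y| = |y'| := by rw [rec_y x y z, rec_y x' y' z', h]
  have hz : |z| = |z'| := by rw [rec_z x y z, rec_z x' y' z', h]
  have h3 := congrFun h 3
  have h4 := congrFun h 4
  have h5 := congrFun h 5
  have h6 := congrFun h 6
  have h7 := congrFun h 7
  have h8 := congrFun h 8
  simp only [hat, Matrix.cons_val] at h3 h4 h5 h6 h7 h8
  have na : ∀ a b c, mp a b (-c) = mp a b c := by intro a b c; simp [mp]
  have nb : ∀ a b c, mp (-a) b c = mp a (-b) c := by
    intro a b c; rw [← mp_neg_neg, neg_neg]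
  have Lz : z = z' ∨ z = - z' := abs_eq_abs.mp hz
  rcases abs_eq_abs.mp hx with rfl | rfl <;> rcases abs_eq_abs.mp hy with rfl | rfl <;>
    rcases Lz with rfl | rfl <;> simp only [na, nb, neg_neg] at h3 h4 h5 h6 h7 h8
  · simp
  · rcases sign_lemma h6 h8 with h | ⟨h, h'⟩ <;> simp [*]
  · have := sign_lemma (x := x) (y := z) (z := y') h4 (by rw [mp_comm, ← mp_comm' ]; assumption)
    rcases this with h | ⟨h, h'⟩ <;> simp [*]
  · have := sign_lemma (x := y') (y := z') (z := x) (by rw [mp_comm, ← mp_comm' ]; exact h4) (by rw [mp_comm, ← mp_comm' ]; exact h6)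
    rcases this with h | ⟨h, h'⟩ <;> simp [*]
  · have := sign_lemma (x := y) (y := z) (z := x') (by rw [mp_comm, ← mp_comm' ]; exact h4) (by rw [mp_comm, ← mp_comm' ]; exact h6)
    rcases this with h | ⟨h, h'⟩ <;> simp [*]
  · have := sign_lemma (x := x') (y := z') (z := y) h4 (by rw [mp_comm, ← mp_comm' ]; assumption)
    rcases this with h | ⟨h, h'⟩ <;> simp [*]
  · rcases sign_lemma h6 h8 with h | ⟨h, h'⟩ <;> simp [*]
  · simp



set_option maxHeartbeats 4000000 in
lemma hat_surj (f : Fin 9 → ℝ) (h0 : ∀ v, 0 ≤ f v) (T : Finset (Fin 9)) (hT : T ∈ tri)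
    (hs : ∀ v, f v ≠ 0 → v ∈ T) : ∃ x y z, hat x y z = f := by
  have hs' : ∀ v ∈ Tᶜ, f v = 0 := by
    intro v hv
    by_contra h
    simp at hv
    exact hv (hs v h)
  have c1 : ∀ a b c d e k : Fin 9, Tᶜ = {a, b, c, d, e, k} → f a = 0 ∧ f b = 0 ∧
      f c = 0 ∧ f d = 0 ∧ f e = 0 ∧ f k = 0 := by
    intro a b c d e k h
    rw [h] at hs'
    simpa using hs'
  have fin : ∀ x y z, (cor x y z = f 0 ∧ cor y x z = f 1 ∧ cor z x y = f 2) →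
      (mp x y z = f 3 ∧ mp x (-y) z = f 4) → (mp x z y = f 5 ∧ mp x (-z) y = f 6) →
      (mp y z x = f 7 ∧ mp y (-z) x = f 8) → ∃ x y z, hat x y z = f := by
    rintro x y z ⟨h0, h1, h2⟩ ⟨h3, h4⟩ ⟨h5, h6⟩ ⟨h7, h8⟩
    refine ⟨x, y, z, ?_⟩
    ext v
    fin_cases v
    exacts [h0, h1, h2, h3, h4, h5, h6, h7, h8]
  have p0 := h0 0
  have p1 := h0 1
  have p2 := h0 2
  have p3 := h0 3
  have p4 := h0 4
  have p5 := h0 5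
  have p6 := h0 6
  have p7 := h0 7
  have p8 := h0 8
  simp only [tri, Finset.mem_insert, Finset.mem_singleton] at hT
  rcases hT with rfl | rfl | rfl | rfl | rfl | rfl | rfl | rfl | rfl | rfl | rfl | rfl | rfl | rfl | rfl | rfl
  · have := c1 1 2 7 8 4 6 (by decide)
    apply fin (f 0 + f 3 + f 5) (f 3) (f 5)
    all_goals clear fin c1 hs hs' h0
    all_goals obtain ⟨e1, e2, e3, e4, e5, e6⟩ := this
    all_goals try simp only [cor, neg_neg]
    all_goals refine ⟨?_, ?_⟩
    all_goals try refine ⟨?_, ?_⟩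
    all_goals first
      | (rw [mp_of_nonpos _ (by (try simp only [mul_neg, neg_mul, neg_neg, Left.neg_nonpos_iff, e1, e2, e3, e4, e5, e6]); positivity)]; linarith)
      | (rw [mp_of_nonneg _ (by (try simp only [mul_neg, neg_mul, neg_neg]); positivity), mm]
         try simp only [abs_neg]
         repeat rw [abs_of_nonneg (by positivity)]
         grind)
      | (try simp only [abs_neg]
         repeat rw [abs_of_nonneg (by positivity)]
         grind)
  · have := c1 1 2 7 8 4 5 (by decide)
    apply fin (f 0 + f 3 + f 6) (f 3) (-f 6)
    all_goals clear fin c1 hs hs' h0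
    all_goals obtain ⟨e1, e2, e3, e4, e5, e6⟩ := this
    all_goals try simp only [cor, neg_neg]
    all_goals refine ⟨?_, ?_⟩
    all_goals try refine ⟨?_, ?_⟩
    all_goals first
      | (rw [mp_of_nonpos _ (by (try simp only [mul_neg, neg_mul, neg_neg, Left.neg_nonpos_iff, e1, e2, e3, e4, e5, e6]); positivity)]; linarith)
      | (rw [mp_of_nonneg _ (by (try simp only [mul_neg, neg_mul, neg_neg]); positivity), mm]
         try simp only [abs_neg]
         repeat rw [abs_of_nonneg (by positivity)]
         grind)
      | (try simp only [abs_neg]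
         repeat rw [abs_of_nonneg (by positivity)]
         grind)
  · have := c1 1 2 7 8 3 6 (by decide)
    apply fin (f 0 + f 4 + f 5) (-f 4) (f 5)
    all_goals clear fin c1 hs hs' h0
    all_goals obtain ⟨e1, e2, e3, e4, e5, e6⟩ := this
    all_goals try simp only [cor, neg_neg]
    all_goals refine ⟨?_, ?_⟩
    all_goals try refine ⟨?_, ?_⟩
    all_goals first
      | (rw [mp_of_nonpos _ (by (try simp only [mul_neg, neg_mul, neg_neg, Left.neg_nonpos_iff, e1, e2, e3, e4, e5, e6]); positivity)]; linarith)
      | (rw [mp_of_nonneg _ (by (try simp only [mul_neg, neg_mul, neg_neg]); positivity), mm]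
         try simp only [abs_neg]
         repeat rw [abs_of_nonneg (by positivity)]
         grind)
      | (try simp only [abs_neg]
         repeat rw [abs_of_nonneg (by positivity)]
         grind)
  · have := c1 1 2 7 8 3 5 (by decide)
    apply fin (f 0 + f 4 + f 6) (-f 4) (-f 6)
    all_goals clear fin c1 hs hs' h0
    all_goals obtain ⟨e1, e2, e3, e4, e5, e6⟩ := this
    all_goals try simp only [cor, neg_neg]
    all_goals refine ⟨?_, ?_⟩
    all_goals try refine ⟨?_, ?_⟩
    all_goals first
      | (rw [mp_of_nonpos _ (by (try simp only [mul_neg, neg_mul, neg_neg, Left.neg_nonpos_iff, e1, e2, e3, e4, e5, e6]); positivity)]; linarith)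
      | (rw [mp_of_nonneg _ (by (try simp only [mul_neg, neg_mul, neg_neg]); positivity), mm]
         try simp only [abs_neg]
         repeat rw [abs_of_nonneg (by positivity)]
         grind)
      | (try simp only [abs_neg]
         repeat rw [abs_of_nonneg (by positivity)]
         grind)
  · have := c1 0 2 5 6 4 8 (by decide)
    apply fin (f 3) (f 1 + f 3 + f 7) (f 7)
    all_goals clear fin c1 hs hs' h0
    all_goals obtain ⟨e1, e2, e3, e4, e5, e6⟩ := this
    all_goals try simp only [cor, neg_neg]
    all_goals refine ⟨?_, ?_⟩
    all_goals try refine ⟨?_, ?_⟩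
    all_goals first
      | (rw [mp_of_nonpos _ (by (try simp only [mul_neg, neg_mul, neg_neg, Left.neg_nonpos_iff, e1, e2, e3, e4, e5, e6]); positivity)]; linarith)
      | (rw [mp_of_nonneg _ (by (try simp only [mul_neg, neg_mul, neg_neg]); positivity), mm]
         try simp only [abs_neg]
         repeat rw [abs_of_nonneg (by positivity)]
         grind)
      | (try simp only [abs_neg]
         repeat rw [abs_of_nonneg (by positivity)]
         grind)
  · have := c1 0 2 5 6 4 7 (by decide)
    apply fin (f 3) (f 1 + f 3 + f 8) (-f 8)
    all_goals clear fin c1 hs hs' h0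
    all_goals obtain ⟨e1, e2, e3, e4, e5, e6⟩ := this
    all_goals try simp only [cor, neg_neg]
    all_goals refine ⟨?_, ?_⟩
    all_goals try refine ⟨?_, ?_⟩
    all_goals first
      | (rw [mp_of_nonpos _ (by (try simp only [mul_neg, neg_mul, neg_neg, Left.neg_nonpos_iff, e1, e2, e3, e4, e5, e6]); positivity)]; linarith)
      | (rw [mp_of_nonneg _ (by (try simp only [mul_neg, neg_mul, neg_neg]); positivity), mm]
         try simp only [abs_neg]
         repeat rw [abs_of_nonneg (by positivity)]
         grind)
      | (try simp only [abs_neg]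
         repeat rw [abs_of_nonneg (by positivity)]
         grind)
  · have := c1 0 2 5 6 3 8 (by decide)
    apply fin (-f 4) (f 1 + f 4 + f 7) (f 7)
    all_goals clear fin c1 hs hs' h0
    all_goals obtain ⟨e1, e2, e3, e4, e5, e6⟩ := this
    all_goals try simp only [cor, neg_neg]
    all_goals refine ⟨?_, ?_⟩
    all_goals try refine ⟨?_, ?_⟩
    all_goals first
      | (rw [mp_of_nonpos _ (by (try simp only [mul_neg, neg_mul, neg_neg, Left.neg_nonpos_iff, e1, e2, e3, e4, e5, e6]); positivity)]; linarith)
      | (rw [mp_of_nonneg _ (by (try simp only [mul_neg, neg_mul, neg_neg]); positivity), mm]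
         try simp only [abs_neg]
         repeat rw [abs_of_nonneg (by positivity)]
         grind)
      | (try simp only [abs_neg]
         repeat rw [abs_of_nonneg (by positivity)]
         grind)
  · have := c1 0 2 5 6 3 7 (by decide)
    apply fin (-f 4) (f 1 + f 4 + f 8) (-f 8)
    all_goals clear fin c1 hs hs' h0
    all_goals obtain ⟨e1, e2, e3, e4, e5, e6⟩ := this
    all_goals try simp only [cor, neg_neg]
    all_goals refine ⟨?_, ?_⟩
    all_goals try refine ⟨?_, ?_⟩
    all_goals first
      | (rw [mp_of_nonpos _ (by (try simp only [mul_neg, neg_mul, neg_neg, Left.neg_nonpos_iff, e1, e2, e3, e4, e5, e6]); positivity)]; linarith)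
      | (rw [mp_of_nonneg _ (by (try simp only [mul_neg, neg_mul, neg_neg]); positivity), mm]
         try simp only [abs_neg]
         repeat rw [abs_of_nonneg (by positivity)]
         grind)
      | (try simp only [abs_neg]
         repeat rw [abs_of_nonneg (by positivity)]
         grind)
  · have := c1 0 1 3 4 6 8 (by decide)
    apply fin (f 5) (f 7) (f 2 + f 5 + f 7)
    all_goals clear fin c1 hs hs' h0
    all_goals obtain ⟨e1, e2, e3, e4, e5, e6⟩ := this
    all_goals try simp only [cor, neg_neg]
    all_goals refine ⟨?_, ?_⟩
    all_goals try refine ⟨?_, ?_⟩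
    all_goals first
      | (rw [mp_of_nonpos _ (by (try simp only [mul_neg, neg_mul, neg_neg, Left.neg_nonpos_iff, e1, e2, e3, e4, e5, e6]); positivity)]; linarith)
      | (rw [mp_of_nonneg _ (by (try simp only [mul_neg, neg_mul, neg_neg]); positivity), mm]
         try simp only [abs_neg]
         repeat rw [abs_of_nonneg (by positivity)]
         grind)
      | (try simp only [abs_neg]
         repeat rw [abs_of_nonneg (by positivity)]
         grind)
  · have := c1 0 1 3 4 6 7 (by decide)
    apply fin (f 5) (-f 8) (f 2 + f 5 + f 8)
    all_goals clear fin c1 hs hs' h0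
    all_goals obtain ⟨e1, e2, e3, e4, e5, e6⟩ := this
    all_goals try simp only [cor, neg_neg]
    all_goals refine ⟨?_, ?_⟩
    all_goals try refine ⟨?_, ?_⟩
    all_goals first
      | (rw [mp_of_nonpos _ (by (try simp only [mul_neg, neg_mul, neg_neg, Left.neg_nonpos_iff, e1, e2, e3, e4, e5, e6]); positivity)]; linarith)
      | (rw [mp_of_nonneg _ (by (try simp only [mul_neg, neg_mul, neg_neg]); positivity), mm]
         try simp only [abs_neg]
         repeat rw [abs_of_nonneg (by positivity)]
         grind)
      | (try simp only [abs_neg]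
         repeat rw [abs_of_nonneg (by positivity)]
         grind)
  · have := c1 0 1 3 4 5 8 (by decide)
    apply fin (-f 6) (f 7) (f 2 + f 6 + f 7)
    all_goals clear fin c1 hs hs' h0
    all_goals obtain ⟨e1, e2, e3, e4, e5, e6⟩ := this
    all_goals try simp only [cor, neg_neg]
    all_goals refine ⟨?_, ?_⟩
    all_goals try refine ⟨?_, ?_⟩
    all_goals first
      | (rw [mp_of_nonpos _ (by (try simp only [mul_neg, neg_mul, neg_neg, Left.neg_nonpos_iff, e1, e2, e3, e4, e5, e6]); positivity)]; linarith)
      | (rw [mp_of_nonneg _ (by (try simp only [mul_neg, neg_mul, neg_neg]); positivity), mm]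
         try simp only [abs_neg]
         repeat rw [abs_of_nonneg (by positivity)]
         grind)
      | (try simp only [abs_neg]
         repeat rw [abs_of_nonneg (by positivity)]
         grind)
  · have := c1 0 1 3 4 5 7 (by decide)
    apply fin (-f 6) (-f 8) (f 2 + f 6 + f 8)
    all_goals clear fin c1 hs hs' h0
    all_goals obtain ⟨e1, e2, e3, e4, e5, e6⟩ := this
    all_goals try simp only [cor, neg_neg]
    all_goals refine ⟨?_, ?_⟩
    all_goals try refine ⟨?_, ?_⟩
    all_goals first
      | (rw [mp_of_nonpos _ (by (try simp only [mul_neg, neg_mul, neg_neg, Left.neg_nonpos_iff, e1, e2, e3, e4, e5, e6]); positivity)]; linarith)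
      | (rw [mp_of_nonneg _ (by (try simp only [mul_neg, neg_mul, neg_neg]); positivity), mm]
         try simp only [abs_neg]
         repeat rw [abs_of_nonneg (by positivity)]
         grind)
      | (try simp only [abs_neg]
         repeat rw [abs_of_nonneg (by positivity)]
         grind)
  · have := c1 0 1 2 4 6 8 (by decide)
    apply fin (f 3 + f 5) (f 3 + f 7) (f 5 + f 7)
    all_goals clear fin c1 hs hs' h0
    all_goals obtain ⟨e1, e2, e3, e4, e5, e6⟩ := this
    all_goals try simp only [cor, neg_neg]
    all_goals refine ⟨?_, ?_⟩
    all_goals try refine ⟨?_, ?_⟩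
    all_goals first
      | (rw [mp_of_nonpos _ (by (try simp only [mul_neg, neg_mul, neg_neg, Left.neg_nonpos_iff, e1, e2, e3, e4, e5, e6]); positivity)]; linarith)
      | (rw [mp_of_nonneg _ (by (try simp only [mul_neg, neg_mul, neg_neg]); positivity), mm]
         try simp only [abs_neg]
         repeat rw [abs_of_nonneg (by positivity)]
         grind)
      | (try simp only [abs_neg]
         repeat rw [abs_of_nonneg (by positivity)]
         grind)
  · have := c1 0 1 2 4 5 7 (by decide)
    apply fin (f 3 + f 6) (f 3 + f 8) (-(f 6 + f 8))
    all_goals clear fin c1 hs hs' h0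
    all_goals obtain ⟨e1, e2, e3, e4, e5, e6⟩ := this
    all_goals try simp only [cor, neg_neg]
    all_goals refine ⟨?_, ?_⟩
    all_goals try refine ⟨?_, ?_⟩
    all_goals first
      | (rw [mp_of_nonpos _ (by (try simp only [mul_neg, neg_mul, neg_neg, Left.neg_nonpos_iff, e1, e2, e3, e4, e5, e6]); positivity)]; linarith)
      | (rw [mp_of_nonneg _ (by (try simp only [mul_neg, neg_mul, neg_neg]); positivity), mm]
         try simp only [abs_neg]
         repeat rw [abs_of_nonneg (by positivity)]
         grind)
      | (try simp only [abs_neg]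
         repeat rw [abs_of_nonneg (by positivity)]
         grind)
  · have := c1 0 1 2 3 6 7 (by decide)
    apply fin (f 4 + f 5) (-(f 4 + f 8)) (f 5 + f 8)
    all_goals clear fin c1 hs hs' h0
    all_goals obtain ⟨e1, e2, e3, e4, e5, e6⟩ := this
    all_goals try simp only [cor, neg_neg]
    all_goals refine ⟨?_, ?_⟩
    all_goals try refine ⟨?_, ?_⟩
    all_goals first
      | (rw [mp_of_nonpos _ (by (try simp only [mul_neg, neg_mul, neg_neg, Left.neg_nonpos_iff, e1, e2, e3, e4, e5, e6]); positivity)]; linarith)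
      | (rw [mp_of_nonneg _ (by (try simp only [mul_neg, neg_mul, neg_neg]); positivity), mm]
         try simp only [abs_neg]
         repeat rw [abs_of_nonneg (by positivity)]
         grind)
      | (try simp only [abs_neg]
         repeat rw [abs_of_nonneg (by positivity)]
         grind)
  · have := c1 0 1 2 3 5 8 (by decide)
    apply fin (f 4 + f 6) (-(f 4 + f 7)) (-(f 6 + f 7))
    all_goals clear fin c1 hs hs' h0
    all_goals obtain ⟨e1, e2, e3, e4, e5, e6⟩ := this
    all_goals try simp only [cor, neg_neg]
    all_goals refine ⟨?_, ?_⟩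
    all_goals try refine ⟨?_, ?_⟩
    all_goals first
      | (rw [mp_of_nonpos _ (by (try simp only [mul_neg, neg_mul, neg_neg, Left.neg_nonpos_iff, e1, e2, e3, e4, e5, e6]); positivity)]; linarith)
      | (rw [mp_of_nonneg _ (by (try simp only [mul_neg, neg_mul, neg_neg]); positivity), mm]
         try simp only [abs_neg]
         repeat rw [abs_of_nonneg (by positivity)]
         grind)
      | (try simp only [abs_neg]
         repeat rw [abs_of_nonneg (by positivity)]
         grind)

/-- The hat functions as functions on `ℝ³`. -/
noncomputable def hh (p : E3) : Fin 9 → ℝ := hat (p 0) (p 1) (p 2)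

lemma hh_cont : Continuous hh := by
  refine continuous_pi fun v => ?_
  fin_cases v <;> simp [hh, hat, cor, mp] <;> fun_prop

lemma hh_smul {c : ℝ} (hc : 0 ≤ c) (p : E3) : hh (c • p) = c • hh p := by
  simp only [hh, PiLp.smul_apply, smul_eq_mul, hat_smul hc]

lemma hh_neg (p : E3) : hh (-p) = hh p := by
  simp only [hh, PiLp.neg_apply, hat_neg]

lemma hh_inj {p p' : E3} (h : hh p = hh p') : p = p' ∨ p = -p' := by
  rcases hat_inj h with ⟨h0, h1, h2⟩ | ⟨h0, h1, h2⟩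
  · left; ext i; fin_cases i <;> simp [h0, h1, h2]
  · right; ext i; fin_cases i <;> simp [h0, h1, h2]

lemma hh_nonneg (p : E3) (v : Fin 9) : 0 ≤ hh p v := hat_nonneg _ _ _ v

lemma hh_zero : hh 0 = 0 := by
  have := hh_smul (c := 0) le_rfl 0
  simpa using this

lemma sum_pos {p : E3} (hp : p ≠ 0) : 0 < ∑ v, hh p v := by
  refine lt_of_le_of_ne (Finset.sum_nonneg fun v _ => hh_nonneg p v) fun h => hp ?_
  have h1 := (Finset.sum_eq_zero_iff_of_nonneg (fun v _ => hh_nonneg p v)).mp h.symm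
  have h2 : hh p = hh 0 := by
    rw [hh_zero]; funext v; exact h1 v (Finset.mem_univ v)
  rcases hh_inj h2 with h | h <;> simpa using h

lemma S2_ne (x : S2) : (x : E3) ≠ 0 := by
  intro h
  have h1 := mem_sphere_zero_iff_norm.mp x.2
  rw [h] at h1; simp at h1

/-- The map from the sphere to the realization. -/
noncomputable def G (x : S2) : geomReal K9 :=
  ⟨(∑ v, hh x v)⁻¹ • hh x, by
    obtain ⟨T, hT, hs⟩ := hat_support ((x : E3) 0) ((x : E3) 1) ((x : E3) 2)
    have hp := sum_pos (S2_ne x)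
    have hTK : T ∈ K9 := by
      simp only [K9, Finset.mem_erase, Finset.mem_biUnion, Finset.mem_powerset]
      refine ⟨?_, T, hT, subset_rfl⟩
      rintro rfl
      revert hT; decide
    refine mem_geom K9_cplx ?_ ?_ hTK ?_
    · intro v
      simp only [Pi.smul_apply, smul_eq_mul]
      exact mul_nonneg (inv_nonneg.mpr hp.le) (hh_nonneg _ v)
    · simp only [Pi.smul_apply, smul_eq_mul, ← Finset.mul_sum]
      exact inv_mul_cancel₀ hp.ne'
    · intro v hv
      apply hs v
      intro h
      apply hv
      have : hh x v = 0 := h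
      simp [this]⟩

lemma G_cont : Continuous G := by
  apply Continuous.subtype_mk
  have h : Continuous fun x : S2 => hh (x : E3) := hh_cont.comp continuous_subtype_val
  have h1 : Continuous fun x : S2 => (∑ v, hh (x : E3) v)⁻¹ :=
    Continuous.inv₀ (continuous_finsetSum _ fun v _ => (continuous_apply v).comp h)
      (fun x => (sum_pos (S2_ne x)).ne')
  exact h1.smul h

lemma G_neg (x : S2) : G (-x) = G x := by
  apply Subtype.ext
  have h : ((-x : S2) : E3) = -(x : E3) := rfl
  simp only [G, h, hh_neg]

lemma G_inj {x y : S2} (h : G x = G y) : x = y ∨ x = -y := by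
  have h1 : (∑ v, hh x v)⁻¹ • hh x = (∑ v, hh y v)⁻¹ • hh y := congrArg Subtype.val h
  have px := inv_pos.mpr (sum_pos (S2_ne x))
  have py := inv_pos.mpr (sum_pos (S2_ne y))
  generalize (∑ v, hh x v)⁻¹ = a at *
  generalize (∑ v, hh y v)⁻¹ = b at *
  rw [← hh_smul px.le, ← hh_smul py.le] at h1
  have nx := mem_sphere_zero_iff_norm.mp x.2
  have ny := mem_sphere_zero_iff_norm.mp y.2
  have hn : ‖a • (x : E3)‖ = ‖b • (y : E3)‖ := by
    rcases hh_inj h1 with h | h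
    · rw [h]
    · rw [h, norm_neg]
  rw [norm_smul, norm_smul, nx, ny, mul_one, mul_one, Real.norm_of_nonneg px.le,
    Real.norm_of_nonneg py.le] at hn
  subst hn
  rcases hh_inj h1 with h | h
  · left; exact Subtype.ext (smul_right_injective E3 px.ne' h)
  · right
    apply Subtype.ext
    apply smul_right_injective E3 px.ne'
    change a • (x : E3) = a • (-(y : E3))
    rw [h, smul_neg]

lemma G_surj (f : geomReal K9) : ∃ x, G x = f := by
  obtain ⟨f, h0, h1, F, hF, hs⟩ := f
  simp only [K9, Finset.mem_erase, Finset.mem_biUnion, Finset.mem_powerset] at hF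
  obtain ⟨_, T, hT, hFT⟩ := hF
  obtain ⟨x, y, z, hxyz⟩ := hat_surj f h0 T hT (by
    intro v hv
    have : v ∈ {v | f v ≠ 0} := hv
    rw [hs] at this
    exact hFT (by simpa using this))
  let p : E3 := !₂[x, y, z]
  have hp : hh p = f := by rw [← hxyz]; simp [hh, p]
  have hpne : p ≠ 0 := by
    intro h
    rw [h, hh_zero] at hp
    rw [← hp] at h1
    simp at h1
  have hn : 0 < ‖p‖⁻¹ := inv_pos.mpr (norm_pos_iff.mpr hpne)
  refine ⟨⟨‖p‖⁻¹ • p, ?_⟩, ?_⟩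
  · rw [mem_sphere_zero_iff_norm, norm_smul, norm_inv, norm_norm,
      inv_mul_cancel₀ (norm_ne_zero_iff.mpr hpne)]
  · apply Subtype.ext
    simp only [G, hh_smul hn.le, hp, Pi.smul_apply, smul_eq_mul, ← Finset.mul_sum, h1, mul_one]
    rw [smul_smul, inv_mul_cancel₀ hn.ne', one_smul]

/-- The induced map on the projective plane. -/
noncomputable def Gq : RealProjPlane → geomReal K9 :=
  Quot.lift G (fun x y h => by
    have : x = -y := Subtype.ext h
    rw [this, G_neg])

lemma Gq_q (x : S2) : Gq (q x) = G x := rfl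

lemma Gq_bij : Function.Bijective Gq := by
  constructor
  · intro a b h
    obtain ⟨x, rfl⟩ := q_quot.surjective a
    obtain ⟨y, rfl⟩ := q_quot.surjective b
    exact q_eq_iff.mpr (G_inj h)
  · intro f
    obtain ⟨x, rfl⟩ := G_surj f
    exact ⟨q x, rfl⟩

lemma Gq_cont : Continuous Gq := q_quot.continuous_iff.mpr G_cont

lemma K9_tri : IsRP2Tri K9 :=
  ⟨K9_cplx, ⟨(Continuous.homeoOfEquivCompactToT2 (f := Equiv.ofBijective Gq Gq_bij)
    Gq_cont).symm⟩⟩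

end upper

end RP2

/-- Every balanced triangulation of `ℝP²` has at least 9 vertices, and there is a
balanced triangulation of `ℝP²` with `f`-vector `(1, 9, 24, 16)` attaining the bound. -/
theorem stmt12 :
    (∀ (n : ℕ) (K : Finset (Finset (Fin n))), IsRP2Tri K → BalancedC 2 K →
      9 ≤ fnum K 0) ∧
    (∃ (n : ℕ) (K : Finset (Finset (Fin n))), IsRP2Tri K ∧ BalancedC 2 K ∧
      fnum K 0 = 9 ∧ fnum K 1 = 24 ∧ fnum K 2 = 16) := by
  exact ⟨fun n K hK hb => RP2.lower hK hb, 9, RP2.K9, RP2.K9_tri, RP2.K9_bal, RP2.K9_f0,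
    RP2.K9_f1, RP2.K9_f2⟩
end
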